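/- Let f₁, f₂ : ℝ² → ℝ be measurable functions with E[f₁(G, Ĝ)⁴] < ∞ and E[f₂(G, Ĝ)⁴] < ∞, where (G, Ĝ) is a standard Gaussian pair with correlation cos θ. For each n ≥ 1 let A₁ := (1/n²) Σ_{i,j=1}^{n} f₁(G_i, Ĝ_j) and A₂ := (1/n²) Σ_{i,j=1}^{n} f₂(G_i, Ĝ_j). Then there exists a constant C (depending only on f₁, f₂ and θ) such that for all n ≥ 1, |E[(A₁ − E[A₁])² (A₂ − E[A₂])]| ≤ C/n². -/

import Mathlib

open MeasureTheory ProbabilityTheory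

/-- The standard Gaussian measure on ℝ. -/
noncomputable def stdGaussian : Measure ℝ := gaussianReal 0 1

/-- `Ĝ = G cos θ + W sin θ` built from a pair `p = (G, W)` of independent standard normals. -/
noncomputable def ghat (θ : ℝ) (p : ℝ × ℝ) : ℝ := p.1 * Real.cos θ + p.2 * Real.sin θ

/-- The mixed moment `J_{a,b}(θ) = E[G^a Ĝ^b · 1{G>0} · 1{Ĝ>0}]`, where `G, W` are
independent standard normals and `Ĝ = G cos θ + W sin θ`. -/
noncomputable def J (a b : ℕ) (θ : ℝ) : ℝ :=
  ∫ p : ℝ × ℝ,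
    p.1 ^ a * ghat θ p ^ b * (if 0 < p.1 then (1 : ℝ) else 0) *
      (if 0 < ghat θ p then (1 : ℝ) else 0)
    ∂(stdGaussian.prod stdGaussian)

/-- The law of the i.i.d. pairs `(G_i, W_i)`. -/
noncomputable def pairLaw : Measure (ℝ × ℝ) := stdGaussian.prod stdGaussian

/-- The joint law of `n` i.i.d. pairs of independent standard normals. -/
noncomputable def piMeasure (n : ℕ) : Measure (Fin n → ℝ × ℝ) :=
  MeasureTheory.Measure.pi fun _ : Fin n => pairLaw


/-- `A_n = (1/n²) Σ_{i,j} f(G_i, Ĝ_j)`. -/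
noncomputable def Afun (n : ℕ) (θ : ℝ) (f : ℝ × ℝ → ℝ) (ω : Fin n → ℝ × ℝ) : ℝ :=
  1 / (n : ℝ) ^ 2 * ∑ i : Fin n, ∑ j : Fin n, f ((ω i).1, ghat θ (ω j))

lemma choose_mul_descFactorial_sub {M m c : ℕ} (hc : c ≤ m) :
    (M - c).choose (m - c) * M.descFactorial c = M.choose m * m.descFactorial c := by
  rw [Nat.descFactorial_eq_factorial_mul_choose, Nat.descFactorial_eq_factorial_mul_choose]
  have := Nat.choose_mul (n := M) hc
  calc _ = c.factorial * (M.choose c * (M - c).choose (m - c)) := by ring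
    _ = _ := by rw [← this]; ring

/-- Weighted count of the `m`-subsets of `W` containing a given `C ⊆ W`. -/
lemma card_powersetCard_superset_mul {C W : Finset ℕ} (hC : C ⊆ W) (m : ℕ) :
    ({R ∈ W.powersetCard m | C ⊆ R}.card : ℝ) * W.card.descFactorial C.card
      = W.card.choose m * m.descFactorial C.card := by
  rcases le_or_gt C.card m with h | h
  · rw [Finset.card_filter_powersetCard_subset _ _ _ hC h]
    exact_mod_cast choose_mul_descFactorial_sub h
  · rw [Nat.descFactorial_of_lt h, Finset.filter_false_of_mem]
    · simp
    · intro R hR hCR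
      have := Finset.card_le_card hCR
      rw [(Finset.mem_powersetCard.1 hR).2] at this
      omega

/-- Extrapolation to `0` of falling factorials from more than `D` nodes. -/
lemma exists_weights_descFactorial (A : Finset ℕ) (D : ℕ) (hA : A.card = D + 1) :
    ∃ w : ℕ → ℝ, ∀ c ≤ D,
      ∑ m ∈ A, w m * (m.descFactorial c : ℝ) = if c = 0 then 1 else 0 := by
  classical
  refine ⟨fun m => (Lagrange.basis A (fun k : ℕ => (k : ℝ)) m).eval 0, fun c hc => ?_⟩
  have hinj : Set.InjOn (fun k : ℕ => (k : ℝ)) A := Nat.cast_injective.injOn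
  have hdeg : (descPochhammer ℝ c).degree < A.card := by
    refine lt_of_le_of_lt Polynomial.degree_le_natDegree ?_
    rw [descPochhammer_natDegree, hA]
    exact_mod_cast Nat.lt_succ_of_le hc
  have h := congrArg (Polynomial.eval 0) (Lagrange.eq_interpolate hinj hdeg)
  rw [Lagrange.interpolate_apply, Polynomial.eval_finsetSum] at h
  simp only [Polynomial.eval_mul, Polynomial.eval_C, descPochhammer_eval_eq_descFactorial] at h
  have h0 : Polynomial.eval 0 (descPochhammer ℝ c) = if c = 0 then 1 else 0 := by
    have := descPochhammer_eval_eq_descFactorial ℝ 0 c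
    rw [Nat.cast_zero] at this
    rw [this]
    rcases c with _ | c <;> simp
  rw [← h0, h]
  exact Finset.sum_congr rfl fun m _ => mul_comm _ _

/-- A family of sums over tuples of boundedly many indices whose integrability depends only on the
size of the index set is always integrable, if it is integrable for infinitely many sizes. -/
lemma integrable_of_infinite_card {Z ι : Type*} [MeasurableSpace Z] {ν : Measure Z}
    (V : ι → Finset ℕ) (I : Finset ℕ → Finset ι) (F : ι → Z → ℝ) (D : ℕ)
    (hI : ∀ t S, t ∈ I S ↔ V t ⊆ S) (hV : ∀ t, (V t).card ≤ D)
    (hcard : ∀ S S' : Finset ℕ, S.card = S'.card → Integrable (fun z => ∑ t ∈ I S, F t z) ν →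
      Integrable (fun z => ∑ t ∈ I S', F t z) ν)
    (hinf : {n | Integrable (fun z => ∑ t ∈ I (Finset.range n), F t z) ν}.Infinite)
    (S : Finset ℕ) : Integrable (fun z => ∑ t ∈ I S, F t z) ν := by
  classical
  set N := {n | Integrable (fun z => ∑ t ∈ I (Finset.range n), F t z) ν} with hN
  have hinf' : {m | S.card + m ∈ N}.Infinite := by
    intro hfin
    refine hinf (((hfin.image (fun m => S.card + m)).union (Set.finite_Iio S.card)).subset ?_)
    intro n hn
    rcases lt_or_ge n S.card with h | h
    · exact Or.inr h
    · exact Or.inl ⟨n - S.card, by simpa [Nat.add_sub_cancel' h] using hn, Nat.add_sub_cancel' h⟩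
  obtain ⟨A, hAN, hA⟩ := hinf'.exists_subset_card_eq (D + 1)
  obtain ⟨w, hw⟩ := exists_weights_descFactorial A D hA
  set M := A.sup id with hM
  obtain ⟨T, hST, hT⟩ := Infinite.exists_superset_card_eq S (S.card + M) (by omega)
  set W := T \ S with hW
  have hWcard : W.card = M := by rw [hW, Finset.card_sdiff_of_subset hST, hT]; omega
  have hAM : ∀ m ∈ A, m ≤ M := fun m hm => Finset.le_sup (f := id) hm
  have hcount : ∀ t ∈ I T, ∑ m ∈ A, w m / (M.choose m : ℝ) *
      ({R ∈ W.powersetCard m | V t \ S ⊆ R}.card : ℝ) = if V t ⊆ S then 1 else 0 := by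
    intro t ht
    have hsub : V t \ S ⊆ W := Finset.sdiff_subset_sdiff ((hI t T).1 ht) le_rfl
    have hne : (M.descFactorial (V t \ S).card : ℝ) ≠ 0 := by
      rw [Nat.cast_ne_zero, Ne, Nat.descFactorial_eq_zero_iff_lt, not_lt, ← hWcard]
      exact Finset.card_le_card hsub
    have key : ∀ m ∈ A, w m / (M.choose m : ℝ) *
        ({R ∈ W.powersetCard m | V t \ S ⊆ R}.card : ℝ)
        = w m * (m.descFactorial (V t \ S).card : ℝ) / M.descFactorial (V t \ S).card := by
      intro m hm
      have h1 := card_powersetCard_superset_mul hsub m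
      rw [hWcard] at h1
      have h2 : (M.choose m : ℝ) ≠ 0 := by
        exact_mod_cast (Nat.choose_pos (hAM m hm)).ne'
      field_simp
      linear_combination h1 * w m
    rw [Finset.sum_congr rfl key, ← Finset.sum_div,
      hw _ ((Finset.card_le_card Finset.sdiff_subset).trans (hV t))]
    simp only [Finset.card_eq_zero, Finset.sdiff_eq_empty_iff_subset]
    split_ifs with h
    · rw [Finset.sdiff_eq_empty_iff_subset.2 h]; simp
    · simp
  have hrep : (fun z => ∑ t ∈ I S, F t z) = fun z => ∑ m ∈ A, ∑ R ∈ W.powersetCard m,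
      w m / (M.choose m : ℝ) * ∑ t ∈ I (S ∪ R), F t z := by
    ext z
    have hTsub : ∀ S' ⊆ T, ∑ t ∈ I S', F t z = ∑ t ∈ I T, if V t ⊆ S' then F t z else 0 := by
      intro S' hS'
      rw [← Finset.sum_filter]
      refine Finset.sum_congr ?_ fun _ _ => rfl
      ext t
      simp only [Finset.mem_filter, hI]
      exact ⟨fun h => ⟨h.trans hS', h⟩, fun h => h.2⟩
    rw [hTsub S hST]
    calc ∑ t ∈ I T, (if V t ⊆ S then F t z else 0)
        = ∑ t ∈ I T, ∑ m ∈ A, ∑ R ∈ W.powersetCard m,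
          w m / (M.choose m : ℝ) * (if V t ⊆ S ∪ R then F t z else 0) := by
          refine Finset.sum_congr rfl fun t ht => ?_
          have : (if V t ⊆ S then F t z else 0) = (if V t ⊆ S then (1 : ℝ) else 0) * F t z := by
            simp
          rw [this, ← hcount t ht, Finset.sum_mul]
          refine Finset.sum_congr rfl fun m _ => ?_
          rw [← Finset.mul_sum, mul_assoc, ← Finset.sum_filter, Finset.sum_const, nsmul_eq_mul]
          have (R : Finset ℕ) : V t \ S ⊆ R ↔ V t ⊆ S ∪ R := sdiff_le_iff
          simp only [this]
      _ = _ := by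
          rw [Finset.sum_comm]
          refine Finset.sum_congr rfl fun m _ => ?_
          rw [Finset.sum_comm]
          refine Finset.sum_congr rfl fun R hR => ?_
          rw [← Finset.mul_sum, hTsub (S ∪ R)]
          exact Finset.union_subset hST
            ((Finset.mem_powersetCard.1 hR).1.trans Finset.sdiff_subset)
  rw [hrep]
  refine integrable_finsetSum _ fun m hm => integrable_finsetSum _ fun R hR => ?_
  refine Integrable.const_mul ?_ _
  refine hcard (Finset.range (S.card + m)) _ ?_ (hAN hm)
  obtain ⟨hR1, hR2⟩ := Finset.mem_powersetCard.1 hR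
  rw [Finset.card_range, Finset.card_union_of_disjoint, hR2]
  exact Finset.disjoint_of_subset_right hR1 Finset.disjoint_sdiff

/-- The part of a sum over index tuples whose set of indices is exactly `S`. -/
noncomputable def exactSum {Z ι : Type*} (V : ι → Finset ℕ) (I : Finset ℕ → Finset ι)
    (F : ι → Z → ℝ) (S : Finset ℕ) (z : Z) : ℝ :=
  ∑ t ∈ I S with V t = S, F t z

section ExactSum

variable {Z ι : Type*} {V : ι → Finset ℕ} {I : Finset ℕ → Finset ι} {F : ι → Z → ℝ}

lemma sum_eq_sum_powerset_exactSum (hI : ∀ t S, t ∈ I S ↔ V t ⊆ S) (S : Finset ℕ) (z : Z) :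
    ∑ t ∈ I S, F t z = ∑ S' ∈ S.powerset, exactSum V I F S' z := by
  classical
  rw [← Finset.sum_fiberwise_of_maps_to (s := I S) (t := S.powerset) (g := V)
    fun t ht => Finset.mem_powerset.2 ((hI t S).1 ht)]
  refine Finset.sum_congr rfl fun S' hS' => Finset.sum_congr ?_ fun _ _ => rfl
  ext t
  simp only [Finset.mem_filter, hI, and_congr_left_iff]
  rintro rfl
  simpa using hS'

lemma exactSum_eq_sub (hI : ∀ t S, t ∈ I S ↔ V t ⊆ S) (S : Finset ℕ) (z : Z) :
    exactSum V I F S z = ∑ t ∈ I S, F t z - ∑ S' ∈ S.ssubsets, exactSum V I F S' z := by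
  classical
  rw [sum_eq_sum_powerset_exactSum hI, Finset.ssubsets,
    ← Finset.sum_erase_add _ _ (Finset.mem_powerset_self S)]
  ring

variable [MeasurableSpace Z] {ν : Measure Z}

lemma integrable_exactSum (hI : ∀ t S, t ∈ I S ↔ V t ⊆ S)
    (hint : ∀ S, Integrable (fun z => ∑ t ∈ I S, F t z) ν) (S : Finset ℕ) :
    Integrable (exactSum V I F S) ν := by
  induction S using Finset.strongInduction with
  | H S ih =>
    have : exactSum V I F S = fun z => ∑ t ∈ I S, F t z
        - ∑ S' ∈ S.ssubsets, exactSum V I F S' z := funext (exactSum_eq_sub hI S)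
    rw [this]
    exact (hint S).sub (integrable_finsetSum _ fun S' hS' => ih S' (Finset.mem_ssubsets.1 hS'))

lemma exists_integral_exactSum_le (hI : ∀ t S, t ∈ I S ↔ V t ⊆ S)
    (hint : ∀ S, Integrable (fun z => ∑ t ∈ I S, F t z) ν)
    (hcard : ∀ S S' : Finset ℕ, S.card = S'.card →
      ∫ z, ∑ t ∈ I S, F t z ∂ν = ∫ z, ∑ t ∈ I S', F t z ∂ν) (k : ℕ) :
    ∃ C, 0 ≤ C ∧ ∀ S, S.card < k → |∫ z, exactSum V I F S z ∂ν| ≤ C := by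
  induction k with
  | zero => exact ⟨0, le_rfl, by simp⟩
  | succ k ih =>
    obtain ⟨C, hC0, hC⟩ := ih
    refine ⟨max C (|∫ z, ∑ t ∈ I (Finset.range k), F t z ∂ν| + 2 ^ k * C), by positivity,
      fun S hS => ?_⟩
    rcases Nat.lt_succ_iff_lt_or_eq.1 hS with h | h
    · exact (hC S h).trans (le_max_left _ _)
    · refine le_trans ?_ (le_max_right _ _)
      simp_rw [exactSum_eq_sub hI S]
      rw [integral_sub (hint S) (integrable_finsetSum _ fun S' _ => integrable_exactSum hI hint S'),
        integral_finsetSum _ fun S' _ => integrable_exactSum hI hint S',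
        hcard S (Finset.range k) (by simpa using h)]
      refine (abs_sub _ _).trans (add_le_add le_rfl ((Finset.abs_sum_le_sum_abs _ _).trans ?_))
      refine (Finset.sum_le_card_nsmul _ _ C fun S' hS' => hC S' ?_).trans ?_
      · exact h ▸ Finset.card_lt_card (Finset.mem_ssubsets.1 hS')
      · rw [nsmul_eq_mul]
        refine mul_le_mul_of_nonneg_right ?_ hC0
        have := Finset.card_le_card (Finset.erase_subset S S.powerset)
        rw [Finset.card_powerset, h] at this
        exact_mod_cast this

/-- If only index sets of size at most `L` contribute to the integral, then the integral over
the index set `range n` grows at most like `n ^ L`. -/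
lemma exists_integral_sum_le_pow (hI : ∀ t S, t ∈ I S ↔ V t ⊆ S)
    (hint : ∀ S, Integrable (fun z => ∑ t ∈ I S, F t z) ν)
    (hcard : ∀ S S' : Finset ℕ, S.card = S'.card →
      ∫ z, ∑ t ∈ I S, F t z ∂ν = ∫ z, ∑ t ∈ I S', F t z ∂ν) (L : ℕ)
    (hzero : ∀ S, L < S.card → ∫ z, exactSum V I F S z ∂ν = 0) :
    ∃ C, ∀ n : ℕ, 1 ≤ n → |∫ z, ∑ t ∈ I (Finset.range n), F t z ∂ν| ≤ C * (n : ℝ) ^ L := by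
  obtain ⟨C, hC0, hC⟩ := exists_integral_exactSum_le hI hint hcard (L + 1)
  refine ⟨(L + 1) * C, fun n hn => ?_⟩
  have hn' : (1 : ℝ) ≤ n := by exact_mod_cast hn
  simp_rw [sum_eq_sum_powerset_exactSum hI]
  rw [integral_finsetSum _ fun S' _ => integrable_exactSum hI hint S']
  calc |∑ S ∈ (Finset.range n).powerset, ∫ z, exactSum V I F S z ∂ν|
      ≤ ∑ S ∈ (Finset.range n).powerset, (if S.card ≤ L then C else 0) := by
        refine (Finset.abs_sum_le_sum_abs _ _).trans (Finset.sum_le_sum fun S _ => ?_)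
        split_ifs with h
        · exact hC S (Nat.lt_succ_of_le h)
        · rw [hzero S (not_le.1 h), abs_zero]
    _ = ∑ m ∈ Finset.range (n + 1), if m ≤ L then (n.choose m : ℝ) * C else 0 := by
        have := Finset.sum_powerset_apply_card (fun m => if m ≤ L then C else 0) (x := Finset.range n)
        rw [this, Finset.card_range]
        simp [nsmul_eq_mul]
    _ ≤ ∑ m ∈ Finset.range (L + 1), (n : ℝ) ^ L * C := by
        rw [← Finset.sum_filter]
        refine (Finset.sum_le_sum (g := fun _ => (n : ℝ) ^ L * C) fun m hm => ?_).trans ?_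
        · refine mul_le_mul_of_nonneg_right ?_ hC0
          have h1 : (n.choose m : ℝ) ≤ (n : ℝ) ^ m := by exact_mod_cast Nat.choose_le_pow n m
          exact h1.trans (pow_le_pow_right₀ hn' (Finset.mem_filter.1 hm).2)
        · refine Finset.sum_le_sum_of_subset_of_nonneg ?_ fun _ _ _ => by positivity
          intro m hm
          simpa [Nat.lt_succ_iff] using (Finset.mem_filter.1 hm).2
    _ = _ := by simp; ring

end ExactSum

section PairSum

variable {Ω : Type*}

/-- The kernel at the pair of indices `e`: `d` on the diagonal and `h` off it. -/
noncomputable def edgeVal (h : Ω → Ω → ℝ) (d : Ω → ℝ) (e : ℕ × ℕ) (z : ℕ → Ω) : ℝ :=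
  if e.1 = e.2 then d (z e.1) else h (z e.1) (z e.2)

/-- The sum of a kernel over all pairs of indices from `S`. -/
noncomputable def pairSum (h : Ω → Ω → ℝ) (d : Ω → ℝ) (S : Finset ℕ) (z : ℕ → Ω) : ℝ :=
  ∑ e ∈ S ×ˢ S, edgeVal h d e z

lemma pairSum_map (h : Ω → Ω → ℝ) (d : Ω → ℝ) (σ : ℕ ↪ ℕ) (S : Finset ℕ) (z : ℕ → Ω) :
    pairSum h d (S.map σ) z = pairSum h d S (z ∘ σ) := by
  simp [pairSum, Finset.sum_product, edgeVal, σ.injective.eq_iff]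

lemma pairSum_mixed_difference {h : Ω → Ω → ℝ} (hs : ∀ x y, h x y = h y x) (d : Ω → ℝ)
    {Y K L : Finset ℕ} (hYK : Disjoint Y K) (hYL : Disjoint Y L) (hKL : Disjoint K L)
    (z : ℕ → Ω) :
    pairSum h d (Y ∪ K ∪ L) z - pairSum h d (Y ∪ K) z - pairSum h d (Y ∪ L) z + pairSum h d Y z
      = 2 * ∑ i ∈ K, ∑ j ∈ L, h (z i) (z j) := by
  have hne : ∀ i ∈ K, ∀ j ∈ L, i ≠ j := fun i hi j hj => by
    rintro rfl
    exact Finset.disjoint_left.1 hKL hi hj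
  have h1 : ∑ i ∈ K, ∑ j ∈ L, edgeVal h d (i, j) z = ∑ i ∈ K, ∑ j ∈ L, h (z i) (z j) :=
    Finset.sum_congr rfl fun i hi => Finset.sum_congr rfl fun j hj => by
      simp [edgeVal, hne i hi j hj]
  have h2 : ∑ j ∈ L, ∑ i ∈ K, edgeVal h d (j, i) z = ∑ i ∈ K, ∑ j ∈ L, h (z i) (z j) := by
    rw [Finset.sum_comm]
    exact Finset.sum_congr rfl fun i hi => Finset.sum_congr rfl fun j hj => by
      simp [edgeVal, (hne i hi j hj).symm, hs (z j) (z i)]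
  have hd : Disjoint (Y ∪ K) L := Finset.disjoint_union_left.2 ⟨hYL, hKL⟩
  simp only [pairSum, Finset.sum_product, Finset.sum_union hd, Finset.sum_union hYK,
    Finset.sum_union hYL, Finset.sum_add_distrib, h1, h2]
  ring

lemma measurable_edgeVal [MeasurableSpace Ω] {h : Ω → Ω → ℝ} {d : Ω → ℝ}
    (hh : Measurable (Function.uncurry h)) (hd : Measurable d) (e : ℕ × ℕ) :
    Measurable (edgeVal h d e) := by
  unfold edgeVal
  split_ifs
  · fun_prop
  · exact hh.comp (f := fun z : ℕ → Ω => (z e.1, z e.2)) (by fun_prop)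

lemma measurable_pairSum [MeasurableSpace Ω] {h : Ω → Ω → ℝ} {d : Ω → ℝ}
    (hh : Measurable (Function.uncurry h)) (hd : Measurable d) (S : Finset ℕ) :
    Measurable (pairSum h d S) :=
  Finset.measurable_fun_sum _ fun e _ => measurable_edgeVal hh hd e

end PairSum

section SeqLaw

variable {Ω : Type*} [MeasurableSpace Ω] (μ : Measure Ω) [IsProbabilityMeasure μ]

/-- The law of an i.i.d. sequence with marginal `μ`. -/
noncomputable abbrev seqLaw : Measure (ℕ → Ω) := Measure.infinitePi fun _ => μ

lemma identDistrib_of_card_eq {G : Finset ℕ → (ℕ → Ω) → ℝ} (hm : ∀ S, Measurable (G S))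
    (hG : ∀ (σ : ℕ ↪ ℕ) S z, G (S.map σ) z = G S (z ∘ σ)) {S S' : Finset ℕ}
    (hS : S.card = S'.card) : IdentDistrib (G S) (G S') (seqLaw μ) (seqLaw μ) := by
  obtain ⟨σ, hσ⟩ : ∃ σ : ℕ ↪ ℕ, S.map σ = S' := by
    let e : S ≃ S' := Finset.equivOfCardEq hS
    obtain ⟨g, hg⟩ := Cardinal.extend_function_of_lt (s := (S : Set ℕ))
      ⟨fun x => (e x : ℕ), fun x y hxy => e.injective (Subtype.ext hxy)⟩
      (by simp) ⟨Equiv.refl ℕ⟩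
    refine ⟨g.toEmbedding, Finset.eq_of_subset_of_card_le ?_ (by simp [hS])⟩
    intro x hx
    obtain ⟨y, hy, rfl⟩ := Finset.mem_map.1 hx
    have := hg ⟨y, hy⟩
    rw [Equiv.coe_toEmbedding, this]
    exact (e ⟨y, hy⟩).2
  refine ⟨(hm S).aemeasurable, (hm S').aemeasurable, ?_⟩
  have h1 : G S' = G S ∘ fun z i => z (σ i) := by
    ext z
    rw [← hσ, hG]
    rfl
  have h2 : Measurable fun (z : ℕ → Ω) i => z (σ i) := by fun_prop
  rw [h1, ← Measure.map_map (hm S) h2,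
    Measure.map_infinitePi_infinitePi_of_inj (P := fun _ : ℕ => μ) σ.injective]

lemma indepFun_restrict {S T : Finset ℕ} (hST : Disjoint S T) :
    IndepFun (fun z (i : S) => z i) (fun z (i : T) => z i) (seqLaw μ) :=
  (iIndepFun_infinitePi (P := fun _ : ℕ => μ) (X := fun _ => id)
    fun _ => measurable_id).indepFun_finset S T hST fun i => by fun_prop

/-- If a product measure charges `B`, then with positive probability several independent first
coordinates lie in `B` together with the same second coordinate. -/
lemma measure_pi_prod_forall_pos {α β ι : Type*} [Fintype ι] [MeasurableSpace α]
    [MeasurableSpace β] (μ : Measure α) (ν : Measure β) [IsProbabilityMeasure μ]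
    [IsProbabilityMeasure ν] {B : Set (α × β)} (hB : MeasurableSet B) (hpos : μ.prod ν B ≠ 0) :
    (Measure.pi fun _ : ι => μ).prod ν {p | ∀ i, (p.1 i, p.2) ∈ B} ≠ 0 := by
  have hset : {p : (ι → α) × β | ∀ i, (p.1 i, p.2) ∈ B} = ⋂ i, (fun p => (p.1 i, p.2)) ⁻¹' B := by
    ext; simp
  have hm : MeasurableSet {p : (ι → α) × β | ∀ i, (p.1 i, p.2) ∈ B} := by
    rw [hset]
    exact MeasurableSet.iInter fun i => hB.preimage (by fun_prop)
  intro h0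
  apply hpos
  rw [Measure.prod_apply_symm hB, lintegral_eq_zero_iff (measurable_measure_prodMk_right hB)]
  rw [Measure.prod_apply_symm hm, lintegral_eq_zero_iff (measurable_measure_prodMk_right hm)] at h0
  filter_upwards [h0] with y hy
  have : (fun x => (x, y)) ⁻¹' {p : (ι → α) × β | ∀ i, (p.1 i, p.2) ∈ B}
      = Set.univ.pi fun _ : ι => (fun x => (x, y)) ⁻¹' B := by
    ext; simp
  rw [this, Measure.pi_pi] at hy
  exact (Finset.prod_eq_zero_iff.1 hy).elim fun _ h => h.2

lemma seqLaw_forall_pair_pos {I J : Finset ℕ} (hIJ : Disjoint I J) {A : Set (Ω × Ω)}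
    (hA : MeasurableSet A) (hpos : μ.prod μ A ≠ 0) :
    seqLaw μ {z | ∀ i ∈ I, ∀ j ∈ J, (z i, z j) ∈ A} ≠ 0 := by
  have h1 := measure_pi_prod_forall_pos (ι := I) μ μ hA hpos
  set A₁ := {p : (I → Ω) × Ω | ∀ i, (p.1 i, p.2) ∈ A} with hA₁
  have hA₁m : MeasurableSet A₁ := by
    have : A₁ = ⋂ i, (fun p => (p.1 i, p.2)) ⁻¹' A := by ext; simp [hA₁]
    rw [this]
    exact MeasurableSet.iInter fun i => hA.preimage (by fun_prop)
  have h2 := measure_pi_prod_forall_pos (ι := J) μ (Measure.pi fun _ : I => μ)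
    (hA₁m.preimage measurable_swap) (by
      rwa [← Measure.map_apply measurable_swap hA₁m, Measure.prod_swap])
  have hind := indepFun_restrict μ hIJ.symm
  rw [indepFun_iff_map_prod_eq_prod_map_map (Measurable.aemeasurable (by fun_prop))
    (Measurable.aemeasurable (by fun_prop))] at hind
  have hI := Measure.infinitePi_map_restrict (fun _ : ℕ => μ) (I := I)
  have hJ := Measure.infinitePi_map_restrict (fun _ : ℕ => μ) (I := J)
  have hI' : (seqLaw μ).map (fun z (i : I) => z i) = Measure.pi fun _ : I => μ := hI
  have hJ' : (seqLaw μ).map (fun z (i : J) => z i) = Measure.pi fun _ : J => μ := hJ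
  rw [hI', hJ'] at hind
  rw [← hind, Measure.map_apply (by fun_prop)] at h2
  · convert h2 using 2
    ext z
    simp only [hA₁, Set.mem_ofPred_eq, Set.mem_preimage, Prod.swap_prod_mk, Subtype.forall]
    exact ⟨fun h j hj i hi => h i hi j hj, fun h i hi j hj => h j hj i hi⟩
  · have : {p : (J → Ω) × (I → Ω) | ∀ j, (p.1 j, p.2) ∈ Prod.swap ⁻¹' A₁}
      = ⋂ j, (fun p => (p.1 j, p.2)) ⁻¹' (Prod.swap ⁻¹' A₁) := by ext; simp
    rw [this]
    exact MeasurableSet.iInter fun i => (hA₁m.preimage measurable_swap).preimage (by fun_prop)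

end SeqLaw

lemma exists_lt_map_eq_of_card_lt {κ : Type*} (Q : Finset κ) {n : ℕ} (hQ : Q.card < n)
    (c : ℕ → κ) (hc : ∀ a, c a ∈ Q) : ∃ a a', a < a' ∧ a' < n ∧ c a = c a' := by
  obtain ⟨x, hx, y, hy, hxy, h⟩ := Finset.exists_ne_map_eq_of_card_lt_of_maps_to
    (s := Finset.range n) (t := Q) (f := c) (by simpa using hQ) fun a _ => hc a
  rcases lt_or_gt_of_ne hxy with h1 | h1
  · exact ⟨x, y, h1, Finset.mem_range.1 hy, h⟩
  · exact ⟨y, x, h1, Finset.mem_range.1 hx, h.symm⟩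

/-- A colouring of a `5 × 101` grid by four colours has a monochromatic rectangle. -/
lemma exists_monochromatic_rectangle {κ : Type*} (Q : Finset κ) (hQ : Q.card = 4)
    (c : ℕ → ℕ → κ) (hc : ∀ a b, c a b ∈ Q) :
    ∃ a a' b b', a < a' ∧ a' < 5 ∧ b < b' ∧ b' < 101 ∧
      c a b = c a b' ∧ c a' b = c a b' ∧ c a' b' = c a b' := by
  choose f g hfg hg hcol using fun b =>
    exists_lt_map_eq_of_card_lt (n := 5) Q (by omega) (fun a => c a b) fun a => hc a b
  obtain ⟨b, b', hb, hb', h⟩ := exists_lt_map_eq_of_card_lt (n := 101)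
    (Finset.range 5 ×ˢ Finset.range 5 ×ˢ Q) (by simp [hQ])
    (fun b => (f b, g b, c (f b) b)) fun b => by
      simpa [hg b, hc] using (hfg b).trans (hg b)
  simp only [Prod.mk.injEq] at h
  obtain ⟨h1, h2, h3⟩ := h
  refine ⟨f b', g b', b, b', hfg b', hg b', hb, hb', ?_, ?_, ?_⟩
  · rw [← h3, h1]
  · rw [← h2, ← hcol b, h3]
  · exact (hcol b').symm

section Nondegenerate

variable {Ω : Type*} {h : Ω → Ω → ℝ} {d : Ω → ℝ}

lemma exists_le_abs_pairSum_of_kernel (hs : ∀ x y, h x y = h y x) {z : ℕ → Ω} {δ s : ℝ}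
    (hδ : 0 < δ) (hs1 : |s| = 1)
    (hz : ∀ i ∈ Finset.Ico 2 6, ∀ j ∈ Finset.Ico 6 106, δ < s * h (z i) (z j)) :
    ∃ R ∈ (Finset.Ico 2 106).powerset, ∀ X ∈ ({0, 1} : Finset ℕ).powerset,
      δ / 2 ≤ |pairSum h d (X ∪ R) z| := by
  by_contra! hcon
  have hmem : ∀ a b, Finset.Ico 2 (2 + min a 4) ∪ Finset.Ico 6 (6 + min b 100)
      ∈ (Finset.Ico 2 106).powerset := by
    intro a b
    rw [Finset.mem_powerset]
    intro i hi
    simp only [Finset.mem_union, Finset.mem_Ico] at hi ⊢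
    omega
  choose c hcQ hc using fun a b => hcon _ (hmem a b)
  obtain ⟨a, a', b, b', ha, ha', hb, hb', h1, h2, h3⟩ :=
    exists_monochromatic_rectangle _ (by simp) c hcQ
  set X := c a b' with hX
  have hXsub : ∀ i ∈ X, i < 2 := fun i hi => by
    have := Finset.mem_powerset.1 (hcQ a b') hi
    simp at this
    omega
  have e1 := hc a b
  have e2 := hc a' b
  have e3 := hc a b'
  have e4 := hc a' b'
  rw [h1] at e1
  rw [h2] at e2
  rw [h3] at e4
  rw [← hX] at e3
  simp only [min_eq_left (show a ≤ 4 by omega), min_eq_left (show a' ≤ 4 by omega),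
    min_eq_left (show b ≤ 100 by omega), min_eq_left (show b' ≤ 100 by omega)] at e1 e2 e3 e4
  have key := pairSum_mixed_difference hs d
    (Y := X ∪ (Finset.Ico 2 (2 + a) ∪ Finset.Ico 6 (6 + b)))
    (K := Finset.Ico (2 + a) (2 + a')) (L := Finset.Ico (6 + b) (6 + b'))
    (by
      rw [Finset.disjoint_left]
      intro i hi hi'
      simp only [Finset.mem_union, Finset.mem_Ico] at hi hi'
      have := hXsub i
      grind)
    (by
      rw [Finset.disjoint_left]
      intro i hi hi'
      simp only [Finset.mem_union, Finset.mem_Ico] at hi hi'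
      have := hXsub i
      grind)
    (by
      rw [Finset.disjoint_left]
      intro i hi hi'
      simp only [Finset.mem_Ico] at hi hi'
      omega) z
  have u1 : X ∪ (Finset.Ico 2 (2 + a) ∪ Finset.Ico 6 (6 + b)) ∪ Finset.Ico (2 + a) (2 + a')
      = X ∪ (Finset.Ico 2 (2 + a') ∪ Finset.Ico 6 (6 + b)) := by
    ext i; simp only [Finset.mem_union, Finset.mem_Ico]; grind
  have u2 : X ∪ (Finset.Ico 2 (2 + a) ∪ Finset.Ico 6 (6 + b)) ∪ Finset.Ico (6 + b) (6 + b')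
      = X ∪ (Finset.Ico 2 (2 + a) ∪ Finset.Ico 6 (6 + b')) := by
    ext i; simp only [Finset.mem_union, Finset.mem_Ico]; grind
  have u3 : X ∪ (Finset.Ico 2 (2 + a') ∪ Finset.Ico 6 (6 + b)) ∪ Finset.Ico (6 + b) (6 + b')
      = X ∪ (Finset.Ico 2 (2 + a') ∪ Finset.Ico 6 (6 + b')) := by
    ext i; simp only [Finset.mem_union, Finset.mem_Ico]; grind
  rw [u1, u2, u3] at key
  have hlow : δ ≤ |∑ i ∈ Finset.Ico (2 + a) (2 + a'), ∑ j ∈ Finset.Ico (6 + b) (6 + b'),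
      h (z i) (z j)| := by
    rw [← one_mul |_|, ← hs1, ← abs_mul, Finset.mul_sum]
    simp_rw [Finset.mul_sum]
    refine le_trans ?_ (le_abs_self _)
    have hpos : ∀ i ∈ Finset.Ico (2 + a) (2 + a'), ∀ j ∈ Finset.Ico (6 + b) (6 + b'),
        δ < s * h (z i) (z j) := fun i hi j hj => by
      simp only [Finset.mem_Ico] at hi hj
      exact hz i (by simp; omega) j (by simp; omega)
    have hi0 : 2 + a ∈ Finset.Ico (2 + a) (2 + a') := by simp [ha]
    have hj0 : 6 + b ∈ Finset.Ico (6 + b) (6 + b') := by simp [hb]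
    refine le_trans ?_ (Finset.single_le_sum (fun i hi => Finset.sum_nonneg fun j hj =>
      (hδ.trans (hpos i hi j hj)).le) hi0)
    refine le_trans ?_ (Finset.single_le_sum (fun j hj => (hδ.trans (hpos _ hi0 j hj)).le) hj0)
    exact (hpos _ hi0 _ hj0).le
  rw [abs_lt] at e1 e2 e3 e4
  rcases le_abs.1 hlow with hl | hl <;> linarith

lemma exists_le_abs_pairSum_of_diagonal {z : ℕ → Ω} {δ s : ℝ}
    (hδ : 0 < δ) (hs1 : |s| = 1) (hz : ∀ i ∈ Finset.Ico 2 6, δ < s * d (z i))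
    (h0 : ∀ i j, i ≠ j → h (z i) (z j) = 0) :
    ∃ R ∈ (Finset.Ico 2 106).powerset, ∀ X ∈ ({0, 1} : Finset ℕ).powerset,
      δ / 2 ≤ |pairSum h d (X ∪ R) z| := by
  by_contra! hcon
  have hsum : ∀ S, pairSum h d S z = ∑ i ∈ S, d (z i) := by
    intro S
    rw [pairSum, Finset.sum_product]
    refine Finset.sum_congr rfl fun i hi => ?_
    rw [Finset.sum_eq_single_of_mem i hi]
    · simp [edgeVal]
    · intro j _ hj
      simp [edgeVal, hj.symm, h0 i j hj.symm]
  have hmem : ∀ a, Finset.Ico 2 (2 + min a 4) ∈ (Finset.Ico 2 106).powerset := by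
    intro a
    rw [Finset.mem_powerset]
    intro i hi
    simp only [Finset.mem_Ico] at hi ⊢
    omega
  choose c hcQ hc using fun a => hcon _ (hmem a)
  obtain ⟨a, a', ha, ha', h1⟩ := exists_lt_map_eq_of_card_lt (n := 5) _ (by simp) c hcQ
  have e1 := hc a
  have e2 := hc a'
  have hXsub : ∀ i ∈ c a', i < 2 := fun i hi => by
    have := Finset.mem_powerset.1 (hcQ a') hi
    simp at this
    omega
  rw [h1] at e1
  simp only [min_eq_left (show a ≤ 4 by omega), min_eq_left (show a' ≤ 4 by omega)] at e1 e2
  have u1 : c a' ∪ Finset.Ico 2 (2 + a') =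
      (c a' ∪ Finset.Ico 2 (2 + a)) ∪ Finset.Ico (2 + a) (2 + a') := by
    ext i; simp only [Finset.mem_union, Finset.mem_Ico]; grind
  rw [u1, hsum, Finset.sum_union (by
      rw [Finset.disjoint_left]
      intro i hi hi'
      simp only [Finset.mem_union, Finset.mem_Ico] at hi hi'
      have := hXsub i
      grind), ← hsum] at e2
  have hlow : δ ≤ |∑ i ∈ Finset.Ico (2 + a) (2 + a'), d (z i)| := by
    rw [← one_mul |_|, ← hs1, ← abs_mul, Finset.mul_sum]
    refine le_trans ?_ (le_abs_self _)
    have hpos : ∀ i ∈ Finset.Ico (2 + a) (2 + a'), δ < s * d (z i) := fun i hi => by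
      simp only [Finset.mem_Ico] at hi
      exact hz i (by simp; omega)
    have hi0 : 2 + a ∈ Finset.Ico (2 + a) (2 + a') := by simp [ha]
    exact (hpos _ hi0).le.trans
      (Finset.single_le_sum (fun i hi => (hδ.trans (hpos i hi)).le) hi0)
  rw [abs_lt] at e1 e2
  rcases le_abs.1 hlow with hl | hl <;> linarith

end Nondegenerate

lemma exists_lt_smul_ne_zero {α : Type*} [MeasurableSpace α] {ν : Measure α} {g : α → ℝ}
    (hg : ¬ g =ᵐ[ν] 0) : ∃ δ s : ℝ, 0 < δ ∧ |s| = 1 ∧ ν {x | δ < s * g x} ≠ 0 := by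
  by_contra! hcon
  apply hg
  have h1 (n : ℕ) := hcon (1 / (n + 1)) 1 (by positivity) (by simp)
  have h2 (n : ℕ) := hcon (1 / (n + 1)) (-1) (by positivity) (by simp)
  have h1' : ∀ᵐ x ∂ν, ∀ n : ℕ, ¬ 1 / ((n : ℝ) + 1) < 1 * g x :=
    ae_all_iff.2 fun n => by simpa [ae_iff] using h1 n
  have h2' : ∀ᵐ x ∂ν, ∀ n : ℕ, ¬ 1 / ((n : ℝ) + 1) < -1 * g x :=
    ae_all_iff.2 fun n => by simpa [ae_iff] using h2 n
  filter_upwards [h1', h2'] with x hx1 hx2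
  by_contra hne
  rcases lt_or_gt_of_ne hne with h | h
  · obtain ⟨n, hn⟩ := exists_nat_one_div_lt (show 0 < -1 * g x by simpa using h)
    exact hx2 n hn
  · obtain ⟨n, hn⟩ := exists_nat_one_div_lt (show 0 < 1 * g x by simpa using h)
    exact hx1 n hn

section Nondegenerate

variable {Ω : Type*} [MeasurableSpace Ω] (μ : Measure Ω) [IsProbabilityMeasure μ]
  {h : Ω → Ω → ℝ} {d : Ω → ℝ}

lemma ae_seqLaw_of_ae {p : Ω → Prop} (hp : ∀ᵐ x ∂μ, p x) (i : ℕ) : ∀ᵐ z ∂seqLaw μ, p (z i) :=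
  (measurePreserving_eval_infinitePi (fun _ : ℕ => μ) i).quasiMeasurePreserving.ae hp

lemma measurePreserving_pair {i j : ℕ} (hij : i ≠ j) :
    MeasurePreserving (fun z => (z i, z j)) (seqLaw μ) (μ.prod μ) :=
  ⟨by fun_prop, Measure.infinitePi_map_eval_prod (P := fun _ : ℕ => μ) hij⟩

lemma ae_seqLaw_of_ae_prod {p : Ω × Ω → Prop} (hp : ∀ᵐ x ∂μ.prod μ, p x) {i j : ℕ}
    (hij : i ≠ j) : ∀ᵐ z ∂seqLaw μ, p (z i, z j) :=
  (measurePreserving_pair μ hij).quasiMeasurePreserving.ae hp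

/-- Unless the kernels vanish, with positive probability over the coordinates `2, …, 105` some
sum of kernels stays away from `0` whatever the coordinates `0` and `1` are. -/
lemma exists_event_le_abs_pairSum (hh : Measurable (Function.uncurry h)) (hd : Measurable d)
    (hs : ∀ x y, h x y = h y x)
    (hne : ¬ (Function.uncurry h =ᵐ[μ.prod μ] 0 ∧ d =ᵐ[μ] 0)) :
    ∃ (W : Set (Finset.Ico 2 106 → Ω)) (ε : ℝ), 0 < ε ∧ MeasurableSet W ∧
      seqLaw μ {z | (fun i : Finset.Ico 2 106 => z i) ∈ W} ≠ 0 ∧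
      ∀ᵐ z ∂seqLaw μ, (fun i : Finset.Ico 2 106 => z i) ∈ W →
        ∃ R ∈ (Finset.Ico 2 106).powerset, ∀ X ∈ ({0, 1} : Finset ℕ).powerset,
          ε ≤ |pairSum h d (X ∪ R) z| := by
  by_cases h0 : Function.uncurry h =ᵐ[μ.prod μ] 0
  · obtain ⟨δ, s, hδ, hs1, hpos⟩ := exists_lt_smul_ne_zero (fun hd0 => hne ⟨h0, hd0⟩)
    refine ⟨{w | ∀ i : Finset.Ico 2 106, (i : ℕ) < 6 → δ < s * d (w i)}, δ / 2, by positivity,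
      ?_, ?_, ?_⟩
    · have hset : {w : Finset.Ico 2 106 → Ω | ∀ i : Finset.Ico 2 106, (i : ℕ) < 6 → δ < s * d (w i)}
        = ⋂ i : Finset.Ico 2 106, ⋂ (_ : (i : ℕ) < 6), {w | δ < s * d (w i)} := by
        ext; simp
      rw [hset]
      refine MeasurableSet.iInter fun i => MeasurableSet.iInter fun _ => ?_
      exact measurableSet_lt measurable_const ((hd.comp (measurable_pi_apply i)).const_mul s)
    · have hset : {z : ℕ → Ω | (fun i : Finset.Ico 2 106 => z i) ∈
          {w : Finset.Ico 2 106 → Ω | ∀ i : Finset.Ico 2 106, (i : ℕ) < 6 → δ < s * d (w i)}}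
          = Set.pi (Finset.Ico 2 6) fun _ => {x | δ < s * d x} := by
        ext z
        simp only [Finset.mem_Ico, Set.mem_ofPred_eq, Subtype.forall, Set.mem_pi,
          Finset.coe_Ico, Set.mem_Ico]
        exact ⟨fun H i hi => H i (by omega) hi.2, fun H i hi hi' => H i (by omega)⟩
      rw [hset, Measure.infinitePi_pi]
      · simpa using hpos
      · exact fun _ _ => measurableSet_lt measurable_const (hd.const_mul s)
    · have hae : ∀ᵐ z ∂seqLaw μ, ∀ i j, i ≠ j → h (z i) (z j) = 0 :=
        ae_all_iff.2 fun i => ae_all_iff.2 fun j => by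
          by_cases hij : i = j
          · simp [hij]
          · filter_upwards [ae_seqLaw_of_ae_prod μ h0 hij] with z hz _ using hz
      filter_upwards [hae] with z hz hzW
      refine exists_le_abs_pairSum_of_diagonal hδ hs1 (fun i hi => ?_) hz
      rw [Finset.mem_Ico] at hi
      exact hzW ⟨i, by simp; omega⟩ hi.2
  · obtain ⟨δ, s, hδ, hs1, hpos⟩ := exists_lt_smul_ne_zero h0
    have hA : MeasurableSet {p : Ω × Ω | δ < s * Function.uncurry h p} :=
      measurableSet_lt measurable_const (hh.const_mul s)
    refine ⟨{w | ∀ i j : Finset.Ico 2 106, (i : ℕ) < 6 → 6 ≤ (j : ℕ) →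
      (w i, w j) ∈ {p : Ω × Ω | δ < s * Function.uncurry h p}}, δ / 2, by positivity, ?_, ?_, ?_⟩
    · have hset : {w : Finset.Ico 2 106 → Ω | ∀ i j : Finset.Ico 2 106, (i : ℕ) < 6 → 6 ≤ (j : ℕ) →
          (w i, w j) ∈ {p : Ω × Ω | δ < s * Function.uncurry h p}}
        = ⋂ i : Finset.Ico 2 106, ⋂ j : Finset.Ico 2 106, ⋂ (_ : (i : ℕ) < 6), ⋂ (_ : 6 ≤ (j : ℕ)),
          (fun w => (w i, w j)) ⁻¹' {p : Ω × Ω | δ < s * Function.uncurry h p} := by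
        ext; simp
      rw [hset]
      refine MeasurableSet.iInter fun i => MeasurableSet.iInter fun j =>
        MeasurableSet.iInter fun _ => MeasurableSet.iInter fun _ => hA.preimage (by fun_prop)
    · convert seqLaw_forall_pair_pos μ (I := Finset.Ico 2 6) (J := Finset.Ico 6 106)
        (by
          rw [Finset.disjoint_left]
          intro i hi hi'
          simp only [Finset.mem_Ico] at hi hi'
          omega) hA hpos using 3
      ext z
      simp only [Finset.mem_Ico, Set.mem_ofPred_eq, Subtype.forall]
      exact ⟨fun H i hi j hj => H i (by omega) j (by omega) hi.2 hj.1,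
        fun H i hi j hj hi' hj' => H i (by omega) j (by omega)⟩
    · refine Filter.Eventually.of_forall fun z hzW =>
        exists_le_abs_pairSum_of_kernel hs hδ hs1 fun i hi j hj => ?_
      rw [Finset.mem_Ico] at hi hj
      exact hzW ⟨i, by simp; omega⟩ ⟨j, by simp; omega⟩ hi.2 hj.1

/-- If products of powers of two sums of kernels are integrable and the first one is nondegenerate,
then the kernel of the second is integrable to the corresponding power. -/
lemma integrable_kernel_pow (hh : Measurable (Function.uncurry h)) (hd : Measurable d)
    (hs : ∀ x y, h x y = h y x)
    (hne : ¬ (Function.uncurry h =ᵐ[μ.prod μ] 0 ∧ d =ᵐ[μ] 0))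
    {h' : Ω → Ω → ℝ} {d' : Ω → ℝ} (hh' : Measurable (Function.uncurry h'))
    (hs' : ∀ x y, h' x y = h' y x) (p q : ℕ)
    (hint : ∀ S, Integrable (fun z => |pairSum h d S z| ^ p * |pairSum h' d' S z| ^ q)
      (seqLaw μ)) :
    Integrable (fun x => |Function.uncurry h' x| ^ q) (μ.prod μ) := by
  obtain ⟨W, ε, hε, hWm, hWpos, hW⟩ := exists_event_le_abs_pairSum μ hh hd hs hne
  have hpair := measurePreserving_pair μ (zero_ne_one' ℕ)
  have hm : Measurable fun x => |Function.uncurry h' x| ^ q := hh'.abs.pow_const q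
  rw [← hpair.integrable_comp hm.aestronglyMeasurable]
  have hr : Measurable fun (z : ℕ → Ω) (i : Finset.Ico 2 106) => z i := by fun_prop
  have hYm : Measurable fun z : ℕ → Ω => W.indicator (fun _ => (1 : ℝ))
      (fun i : Finset.Ico 2 106 => z i) := (measurable_const.indicator hWm).comp hr
  have hind : IndepFun ((fun x => |Function.uncurry h' x| ^ q) ∘ fun z : ℕ → Ω => (z 0, z 1))
      (fun z : ℕ → Ω => W.indicator (fun _ => (1 : ℝ)) (fun i : Finset.Ico 2 106 => z i))
      (seqLaw μ) := by
    have hi := indepFun_restrict μ (S := {0, 1}) (T := Finset.Ico 2 106) (by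
      rw [Finset.disjoint_left]
      intro i hi hi'
      simp at hi hi'
      omega)
    exact hi.comp (φ := fun w : ({0, 1} : Finset ℕ) → Ω =>
      |Function.uncurry h' (w ⟨0, by simp⟩, w ⟨1, by simp⟩)| ^ q)
      (ψ := W.indicator fun _ => (1 : ℝ)) (hm.comp (by fun_prop)) (measurable_const.indicator hWm)
  refine hind.integrable_left_of_integrable_op (fun x y => x * y) 1 one_ne_zero
    (fun x y => by simp [enorm_mul]) ?_ (hm.comp (by fun_prop)).aestronglyMeasurable
    hYm.aestronglyMeasurable ?_
  · have hbd : Integrable (fun z => 2 ^ q * ε⁻¹ ^ p * ∑ R ∈ (Finset.Ico 2 106).powerset,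
        ∑ X ∈ ({0, 1} : Finset ℕ).powerset,
          |pairSum h d (X ∪ R) z| ^ p * |pairSum h' d' (X ∪ R) z| ^ q) (seqLaw μ) :=
      (integrable_finsetSum _ fun R _ => integrable_finsetSum _ fun X _ => hint _).const_mul _
    refine hbd.mono' ((hm.comp (by fun_prop)).mul hYm).aestronglyMeasurable ?_
    filter_upwards [hW] with z hz
    have hnn : ∀ R X : Finset ℕ,
      0 ≤ |pairSum h d (X ∪ R) z| ^ p * |pairSum h' d' (X ∪ R) z| ^ q := fun _ _ => by positivity
    by_cases hzW : (fun i : Finset.Ico 2 106 => z i) ∈ W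
    · obtain ⟨R, hR, hRX⟩ := hz hzW
      have hR2 : ∀ i ∈ R, 2 ≤ i := fun i hi =>
        (Finset.mem_Ico.1 (Finset.mem_powerset.1 hR hi)).1
      have key := pairSum_mixed_difference hs' d' (Y := R) (K := {0}) (L := {1})
        (by simpa using fun h => by simpa using hR2 0 h)
        (by simpa using fun h => by simpa using hR2 1 h) (by simp) z
      simp only [Finset.sum_singleton] at key
      obtain ⟨X, hX, hXle⟩ : ∃ X ∈ ({0, 1} : Finset ℕ).powerset,
          |h' (z 0) (z 1)| ≤ 2 * |pairSum h' d' (X ∪ R) z| := by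
        by_contra! hcon
        have a1 := hcon ∅ (by simp)
        have a2 := hcon {0} (by simp)
        have a3 := hcon {1} (by simp)
        have a4 := hcon {0, 1} (by simp)
        rw [Finset.empty_union] at a1
        rw [Finset.union_comm] at a2 a3 a4
        have : R ∪ {0, 1} = R ∪ {0} ∪ {1} := by ext; simp
        rw [this] at a4
        have b := abs_add_le (pairSum h' d' (R ∪ {0} ∪ {1}) z - pairSum h' d' (R ∪ {0}) z
          - pairSum h' d' (R ∪ {1}) z) (pairSum h' d' R z)
        have b2 := abs_sub (pairSum h' d' (R ∪ {0} ∪ {1}) z - pairSum h' d' (R ∪ {0}) z)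
          (pairSum h' d' (R ∪ {1}) z)
        have b3 := abs_sub (pairSum h' d' (R ∪ {0} ∪ {1}) z) (pairSum h' d' (R ∪ {0}) z)
        rw [key, abs_mul, abs_two] at b
        linarith
      have hge := hRX X hX
      simp only [Set.indicator_of_mem hzW, mul_one, Function.comp, Function.uncurry, norm_pow,
        Real.norm_eq_abs, abs_abs]
      calc |h' (z 0) (z 1)| ^ q ≤ (2 * |pairSum h' d' (X ∪ R) z|) ^ q :=
            pow_le_pow_left₀ (abs_nonneg _) hXle q
        _ = 2 ^ q * ε⁻¹ ^ p * (ε ^ p * |pairSum h' d' (X ∪ R) z| ^ q) := by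
            rw [mul_pow, inv_pow]; field_simp
        _ ≤ 2 ^ q * ε⁻¹ ^ p * (|pairSum h d (X ∪ R) z| ^ p * |pairSum h' d' (X ∪ R) z| ^ q) := by
            gcongr
        _ ≤ _ := by
            refine mul_le_mul_of_nonneg_left ?_ (by positivity)
            refine le_trans ?_ (Finset.single_le_sum (fun R _ => Finset.sum_nonneg fun X _ =>
              hnn R X) hR)
            exact Finset.single_le_sum (f := fun X => |pairSum h d (X ∪ R) z| ^ p
              * |pairSum h' d' (X ∪ R) z| ^ q) (fun X _ => hnn R X) hX
    · rw [Set.indicator_of_notMem hzW]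
      simp only [mul_zero, norm_zero]
      exact mul_nonneg (by positivity)
        (Finset.sum_nonneg fun R _ => Finset.sum_nonneg fun X _ => hnn R X)
  · intro h0
    apply hWpos
    rw [Filter.EventuallyEq, ae_iff] at h0
    convert h0 using 2
    ext z
    simp

end Nondegenerate

section Independence

variable {Ω : Type*} [MeasurableSpace Ω] (μ : Measure Ω) [IsProbabilityMeasure μ]

lemma indepFun_of_dependsOn {A B : (ℕ → Ω) → ℝ} (hA : Measurable A) (hB : Measurable B)
    {S T : Finset ℕ} (hST : Disjoint S T) (hAS : DependsOn A S) (hBT : DependsOn B T) :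
    IndepFun A B (seqLaw μ) := by
  classical
  obtain ⟨x₀⟩ : Nonempty Ω := nonempty_of_isProbabilityMeasure μ
  have hfac : ∀ {f : (ℕ → Ω) → ℝ} {U : Finset ℕ}, DependsOn f U →
      f = (fun w : U → Ω => f fun i => if hi : i ∈ U then w ⟨i, hi⟩ else x₀) ∘
        fun z (i : U) => z i := by
    intro f U hf
    ext z
    exact hf fun i hi => by simp [Finset.mem_coe.1 hi]
  have hmeas : ∀ (U : Finset ℕ), Measurable fun (w : U → Ω) (i : ℕ) =>
      if hi : i ∈ U then w ⟨i, hi⟩ else x₀ := by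
    intro U
    refine measurable_pi_lambda _ fun i => ?_
    split_ifs
    · exact measurable_pi_apply _
    · exact measurable_const
  rw [hfac hAS, hfac hBT]
  exact (indepFun_restrict μ hST).comp (hA.comp (hmeas S)) (hB.comp (hmeas T))

end Independence

section CutVal

variable {Ω : Type*}

/-- The kernel at the pair of indices `e`, set to zero unless both points lie in `G`. -/
noncomputable def cutVal (G : Set Ω) (h : Ω → Ω → ℝ) (d : Ω → ℝ) (e : ℕ × ℕ) (z : ℕ → Ω) : ℝ :=
  G.indicator 1 (z e.1) * G.indicator 1 (z e.2) * edgeVal h d e z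

/-- The indices occurring in a pair. -/
def verts (e : ℕ × ℕ) : Finset ℕ := {e.1, e.2}

lemma indicator_one_nonneg (G : Set Ω) (x : Ω) : (0 : ℝ) ≤ G.indicator 1 x :=
  Set.indicator_nonneg (fun _ _ => zero_le_one) x

lemma indicator_one_le_one (G : Set Ω) (x : Ω) : G.indicator 1 x ≤ (1 : ℝ) :=
  Set.indicator_le_self' (fun _ _ => zero_le_one) x

lemma abs_cutVal_le (G : Set Ω) (h : Ω → Ω → ℝ) (d : Ω → ℝ) (e : ℕ × ℕ) (z : ℕ → Ω) :
    |cutVal G h d e z| ≤ |edgeVal h d e z| := by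
  rw [cutVal, abs_mul]
  refine mul_le_of_le_one_left (abs_nonneg _) ?_
  rw [abs_of_nonneg (mul_nonneg (indicator_one_nonneg _ _) (indicator_one_nonneg _ _))]
  exact mul_le_one₀ (indicator_one_le_one _ _) (indicator_one_nonneg _ _) (indicator_one_le_one _ _)

lemma abs_edgeVal_sub_cutVal_le (G : Set Ω) (h : Ω → Ω → ℝ) (d : Ω → ℝ) (e : ℕ × ℕ) (z : ℕ → Ω) :
    |edgeVal h d e z - cutVal G h d e z| ≤ |edgeVal h d e z| *
      (Gᶜ.indicator 1 (z e.1) + Gᶜ.indicator 1 (z e.2)) := by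
  have hn := abs_nonneg (edgeVal h d e z)
  rw [cutVal]
  by_cases h1 : z e.1 ∈ G <;> by_cases h2 : z e.2 ∈ G <;> simp [h1, h2]
  linarith

lemma dependsOn_edgeVal (h : Ω → Ω → ℝ) (d : Ω → ℝ) (e : ℕ × ℕ) :
    DependsOn (edgeVal h d e) (verts e) := by
  intro z z' hz
  simp only [verts, Finset.coe_insert, Finset.coe_singleton, Set.mem_insert_iff,
    Set.mem_singleton_iff, forall_eq_or_imp, forall_eq] at hz
  simp [edgeVal, hz.1, hz.2]

lemma dependsOn_cutVal (G : Set Ω) (h : Ω → Ω → ℝ) (d : Ω → ℝ) (e : ℕ × ℕ) :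
    DependsOn (cutVal G h d e) (verts e) := by
  intro z z' hz
  have h1 := dependsOn_edgeVal h d e hz
  simp only [verts, Finset.coe_insert, Finset.coe_singleton, Set.mem_insert_iff,
    Set.mem_singleton_iff, forall_eq_or_imp, forall_eq] at hz
  simp only [cutVal, hz.1, hz.2, h1]

lemma dependsOn_mul {f g : (ℕ → Ω) → ℝ} {S T : Finset ℕ} (hf : DependsOn f S)
    (hg : DependsOn g T) : DependsOn (fun z => f z * g z) (S ∪ T : Finset ℕ) := by
  intro z z' hz
  have h1 := hf (x := z) (y := z') fun i hi => hz i (by simp at hi ⊢; exact Or.inl hi)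
  have h2 := hg (x := z) (y := z') fun i hi => hz i (by simp at hi ⊢; exact Or.inr hi)
  simp only [h1, h2]

variable [MeasurableSpace Ω] {μ : Measure Ω} {h : Ω → Ω → ℝ} {d : Ω → ℝ}

lemma measurable_indicator_one_eval {G : Set Ω} (hG : MeasurableSet G) (i : ℕ) :
    Measurable fun z : ℕ → Ω => (G.indicator 1 (z i) : ℝ) :=
  (measurable_one.indicator hG).comp (measurable_pi_apply i)

lemma measurable_cutVal {G : Set Ω} (hG : MeasurableSet G) (hh : Measurable (Function.uncurry h))
    (hd : Measurable d) (e : ℕ × ℕ) : Measurable (cutVal G h d e) :=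
  ((measurable_indicator_one_eval hG _).mul (measurable_indicator_one_eval hG _)).mul
    (measurable_edgeVal hh hd e)

lemma memLp_cutVal {p : ENNReal} {G : Set Ω} (hG : MeasurableSet G)
    (hhm : Measurable (Function.uncurry h)) (hdm : Measurable d) {e : ℕ × ℕ}
    (hp : MemLp (edgeVal h d e) p (seqLaw μ)) : MemLp (cutVal G h d e) p (seqLaw μ) :=
  hp.mono (measurable_cutVal hG hhm hdm e).aestronglyMeasurable
    (Filter.Eventually.of_forall fun z => abs_cutVal_le G h d e z)

variable [IsProbabilityMeasure μ]

lemma memLp_edgeVal {p : ENNReal} (hh : MemLp (Function.uncurry h) p (μ.prod μ))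
    (hd : MemLp d p μ) (e : ℕ × ℕ) : MemLp (edgeVal h d e) p (seqLaw μ) := by
  by_cases he : e.1 = e.2
  · have : edgeVal h d e = d ∘ fun z => z e.1 := by ext; simp [edgeVal, he]
    rw [this]
    exact hd.comp_measurePreserving (measurePreserving_eval_infinitePi (fun _ : ℕ => μ) e.1)
  · have : edgeVal h d e = Function.uncurry h ∘ fun z => (z e.1, z e.2) := by
      ext; simp [edgeVal, he]
    rw [this]
    exact hh.comp_measurePreserving (measurePreserving_pair μ he)

lemma integral_edgeVal_eq_zero (hhm : Measurable (Function.uncurry h)) (hdm : Measurable d)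
    (hh : ∫ x, Function.uncurry h x ∂μ.prod μ = 0)
    (hd : ∫ x, d x ∂μ = 0) (e : ℕ × ℕ) : ∫ z, edgeVal h d e z ∂seqLaw μ = 0 := by
  by_cases he : e.1 = e.2
  · have hp := measurePreserving_eval_infinitePi (fun _ : ℕ => μ) e.1
    have : edgeVal h d e = fun z => d (z e.1) := by ext; simp [edgeVal, he]
    rw [this]
    have hi := integral_map (μ := seqLaw μ) hp.measurable.aemeasurable (f := d) hdm.aestronglyMeasurable
    rw [hp.map_eq] at hi
    exact hi.symm.trans hd
  · have : edgeVal h d e = fun z => Function.uncurry h (z e.1, z e.2) := by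
      ext; simp [edgeVal, he]
    rw [this]
    have hp := measurePreserving_pair μ he
    rw [← hh, ← hp.map_eq]
    exact (integral_map hp.measurable.aemeasurable hhm.aestronglyMeasurable).symm

lemma tendsto_integral_cutVal {G : ℕ → Set Ω} (hG : ∀ k, MeasurableSet (G k))
    (hGe : ∀ᵐ x ∂μ, ∀ᶠ k in Filter.atTop, x ∈ G k) (hhm : Measurable (Function.uncurry h))
    (hdm : Measurable d) {e : ℕ × ℕ} (hint : Integrable (edgeVal h d e) (seqLaw μ)) :
    Filter.Tendsto (fun k => ∫ z, cutVal (G k) h d e z ∂seqLaw μ) Filter.atTop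
      (nhds (∫ z, edgeVal h d e z ∂seqLaw μ)) := by
  refine tendsto_integral_of_dominated_convergence _
    (fun k => (measurable_cutVal (hG k) hhm hdm e).aestronglyMeasurable) hint.norm
    (fun k => Filter.Eventually.of_forall fun z => abs_cutVal_le (G k) h d e z) ?_
  filter_upwards [ae_seqLaw_of_ae μ hGe e.1, ae_seqLaw_of_ae μ hGe e.2] with z h1 h2
  refine tendsto_const_nhds.congr' ?_
  filter_upwards [h1, h2] with k hk1 hk2
  simp [cutVal, hk1, hk2]

end CutVal

section CutSet

variable {Ω : Type*} [MeasurableSpace Ω] (μ : Measure Ω)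

/-- The points at which the first marginal of `|h|` is at most `r ^ 2`. -/
def cutSet (h : Ω → Ω → ℝ) (r : ℕ) : Set Ω := {x | ∫⁻ y, ‖h x y‖ₑ ∂μ ≤ (r : ENNReal) ^ 2}

variable {μ} {h : Ω → Ω → ℝ}

lemma mul_abs_mul_indicator_cutSet_compl_le {x : Ω} (hx : ∫⁻ y, ‖h x y‖ₑ ∂μ < ⊤) (r : ℕ) (a : ℝ) :
    r * (|a| * (cutSet μ h r)ᶜ.indicator 1 x) ≤ a ^ 2 + (∫⁻ y, ‖h x y‖ₑ ∂μ).toReal := by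
  by_cases hr : x ∈ cutSet μ h r
  · simp [hr]
    positivity
  · have h1 : (r : ℝ) ^ 2 ≤ (∫⁻ y, ‖h x y‖ₑ ∂μ).toReal := by
      have := ENNReal.toReal_mono hx.ne (not_le.1 hr).le
      simpa using this
    simp only [Set.mem_compl_iff, hr, not_false_eq_true, Set.indicator_of_mem, Pi.one_apply,
      mul_one]
    nlinarith [sq_nonneg ((r : ℝ) - |a|), sq_abs a, sq_nonneg (r : ℝ), sq_nonneg a]

variable [IsProbabilityMeasure μ]

lemma measurable_lintegral_kernel (hh : Measurable (Function.uncurry h)) :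
    Measurable fun x => ∫⁻ y, ‖h x y‖ₑ ∂μ :=
  Measurable.lintegral_prod_right (f := fun x y => ‖h x y‖ₑ) hh.enorm

lemma measurableSet_cutSet (hh : Measurable (Function.uncurry h)) (r : ℕ) :
    MeasurableSet (cutSet μ h r) :=
  measurableSet_le (measurable_lintegral_kernel hh) measurable_const

lemma lintegral_lintegral_kernel_ne_top (hint : Integrable (Function.uncurry h) (μ.prod μ)) :
    ∫⁻ x, ∫⁻ y, ‖h x y‖ₑ ∂μ ∂μ ≠ ⊤ := by
  have h1 := hint.hasFiniteIntegral
  rw [hasFiniteIntegral_iff_enorm, lintegral_prod _ hint.aestronglyMeasurable.enorm] at h1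
  exact h1.ne

lemma ae_lintegral_kernel_lt_top (hh : Measurable (Function.uncurry h))
    (hint : Integrable (Function.uncurry h) (μ.prod μ)) :
    ∀ᵐ x ∂μ, ∫⁻ y, ‖h x y‖ₑ ∂μ < ⊤ :=
  ae_lt_top (measurable_lintegral_kernel hh) (lintegral_lintegral_kernel_ne_top hint)

lemma ae_eventually_mem_cutSet (hh : Measurable (Function.uncurry h))
    (hint : Integrable (Function.uncurry h) (μ.prod μ)) :
    ∀ᵐ x ∂μ, ∀ᶠ r in Filter.atTop, x ∈ cutSet μ h r := by
  filter_upwards [ae_lintegral_kernel_lt_top hh hint] with x hx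
  obtain ⟨n, hn⟩ := ENNReal.exists_nat_gt hx.ne
  filter_upwards [Filter.eventually_ge_atTop n] with r hr
  refine hn.le.trans ?_
  exact_mod_cast hr.trans (Nat.le_self_pow two_ne_zero r)

lemma integrable_toReal_lintegral_kernel (hh : Measurable (Function.uncurry h))
    (hint : Integrable (Function.uncurry h) (μ.prod μ)) :
    Integrable (fun x => (∫⁻ y, ‖h x y‖ₑ ∂μ).toReal) μ :=
  integrable_toReal_of_lintegral_ne_top (measurable_lintegral_kernel hh).aemeasurable
    (lintegral_lintegral_kernel_ne_top hint)

lemma tendsto_mul_integral_cutVal (hh : Measurable (Function.uncurry h))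
    (hint : Integrable (Function.uncurry h) (μ.prod μ)) {h' : Ω → Ω → ℝ} {d' : Ω → ℝ}
    (hhm : Measurable (Function.uncurry h')) (hdm : Measurable d') {e : ℕ × ℕ}
    (hL : MemLp (edgeVal h' d' e) 2 (seqLaw μ)) (h0 : ∫ z, edgeVal h' d' e z ∂seqLaw μ = 0) :
    Filter.Tendsto (fun r : ℕ => r * ∫ z, cutVal (cutSet μ h r) h' d' e z ∂seqLaw μ) Filter.atTop
      (nhds 0) := by
  set b : Ω → ℝ := fun x => (∫⁻ y, ‖h x y‖ₑ ∂μ).toReal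
  have hb (i : ℕ) : Integrable (fun z : ℕ → Ω => b (z i)) (seqLaw μ) :=
    (measurePreserving_eval_infinitePi (fun _ : ℕ => μ) i).integrable_comp_of_integrable
      (integrable_toReal_lintegral_kernel hh hint)
  have hE : Integrable (edgeVal h' d' e) (seqLaw μ) := hL.integrable one_le_two
  have hC (r : ℕ) : Integrable (cutVal (cutSet μ h r) h' d' e) (seqLaw μ) :=
    memLp_one_iff_integrable.1
      (memLp_cutVal (measurableSet_cutSet hh r) hhm hdm (memLp_one_iff_integrable.2 hE))
  have key : Filter.Tendsto (fun r : ℕ => ∫ z, r * (cutVal (cutSet μ h r) h' d' e z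
      - edgeVal h' d' e z) ∂seqLaw μ) Filter.atTop (nhds (∫ z, 0 ∂seqLaw μ)) := by
    refine tendsto_integral_of_dominated_convergence
      (fun z => 2 * edgeVal h' d' e z ^ 2 + b (z e.1) + b (z e.2))
      (fun r => (((hC r).sub hE).const_mul _).aestronglyMeasurable)
      (((hL.integrable_sq.const_mul 2).add (hb _)).add (hb _)) (fun r => ?_) ?_
    · filter_upwards [ae_seqLaw_of_ae μ (ae_lintegral_kernel_lt_top hh hint) e.1,
        ae_seqLaw_of_ae μ (ae_lintegral_kernel_lt_top hh hint) e.2] with z h1 h2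
      have e1 := mul_abs_mul_indicator_cutSet_compl_le h1 r (edgeVal h' d' e z)
      have e2 := mul_abs_mul_indicator_cutSet_compl_le h2 r (edgeVal h' d' e z)
      have e3 := mul_le_mul_of_nonneg_left
        (abs_edgeVal_sub_cutVal_le (cutSet μ h r) h' d' e z) (Nat.cast_nonneg (α := ℝ) r)
      rw [Real.norm_eq_abs, abs_mul, Nat.abs_cast, abs_sub_comm]
      simp only [b]
      linarith
    · filter_upwards [ae_seqLaw_of_ae μ (ae_eventually_mem_cutSet hh hint) e.1,
        ae_seqLaw_of_ae μ (ae_eventually_mem_cutSet hh hint) e.2] with z h1 h2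
      refine tendsto_const_nhds.congr' ?_
      filter_upwards [h1, h2] with k hk1 hk2
      simp [cutVal, hk1, hk2]
  rw [integral_zero] at key
  refine key.congr fun r => ?_
  rw [integral_const_mul, integral_sub (hC r) hE, h0, sub_zero]

lemma lintegral_seqLaw_mul {u w : Ω × Ω → ENNReal} (hu : Measurable u) (hw : Measurable w)
    {v a b : ℕ} (hva : v ≠ a) (hvb : v ≠ b) (hab : a ≠ b) :
    ∫⁻ z, u (z v, z a) * w (z v, z b) ∂seqLaw μ
      = ∫⁻ x, (∫⁻ y, u (x, y) ∂μ) * ∫⁻ y, w (x, y) ∂μ ∂μ := by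
  have hind : IndepFun (fun z : ℕ → Ω => (z v, z a)) (fun z => z b) (seqLaw μ) :=
    (iIndepFun_infinitePi (P := fun _ : ℕ => μ) (X := fun _ => id)
      fun _ => measurable_id).indepFun_prodMk (fun i => by fun_prop) v a b hvb hab
  have hmap : (seqLaw μ).map (fun z => ((z v, z a), z b)) = (μ.prod μ).prod μ := by
    rw [(indepFun_iff_map_prod_eq_prod_map_map
      (by fun_prop) (measurable_pi_apply b).aemeasurable).1 hind,
      (measurePreserving_pair μ hva).map_eq,
      (measurePreserving_eval_infinitePi (fun _ : ℕ => μ) b).map_eq]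
  have hg : Measurable fun p : (Ω × Ω) × Ω => u p.1 * w (p.1.1, p.2) := by fun_prop
  have h1 := lintegral_map (μ := seqLaw μ) hg
    (show Measurable fun z : ℕ → Ω => ((z v, z a), z b) by fun_prop)
  have hW : Measurable fun x => ∫⁻ y, w (x, y) ∂μ := hw.lintegral_prod_right'
  rw [← h1, hmap, lintegral_prod _ hg.aemeasurable]
  have h2 (p : Ω × Ω) : ∫⁻ y, u p * w (p.1, y) ∂μ = u p * ∫⁻ y, w (p.1, y) ∂μ :=
    lintegral_const_mul _ (hw.comp (measurable_const.prodMk measurable_id))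
  simp_rw [h2]
  rw [lintegral_prod (fun p : Ω × Ω => u p * ∫⁻ y, w (p.1, y) ∂μ)
    (hu.mul (hW.comp measurable_fst)).aemeasurable]
  exact lintegral_congr fun x =>
    lintegral_mul_const (μ := μ) (f := fun y => u (x, y)) (∫⁻ y, w (x, y) ∂μ) (by fun_prop)

lemma lintegral_enorm_cutVal_mul_le (hh : Measurable (Function.uncurry h))
    (hint : Integrable (Function.uncurry h) (μ.prod μ)) {h' : Ω → Ω → ℝ}
    (hhm : Measurable (Function.uncurry h')) (hL : MemLp (Function.uncurry h') 2 (μ.prod μ))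
    (d d' : Ω → ℝ) : ∃ C : ENNReal, C ≠ ⊤ ∧ ∀ (r : ℕ), 1 ≤ r → ∀ v a b : ℕ, v ≠ a → v ≠ b →
      a ≠ b → ∫⁻ z, ‖cutVal (cutSet μ h r) h' d' (v, a) z * cutVal (cutSet μ h r) h d (v, b) z‖ₑ
        ∂seqLaw μ ≤ r * C := by
  refine ⟨∫⁻ p, ‖Function.uncurry h' p‖ₑ ^ 2 ∂μ.prod μ
    + ∫⁻ p, ‖Function.uncurry h p‖ₑ ∂μ.prod μ, ?_, fun r hr v a b hva hvb hab => ?_⟩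
  · have h1 := hint.hasFiniteIntegral
    have h2 := hL.integrable_sq.hasFiniteIntegral
    simp only [hasFiniteIntegral_iff_enorm, enorm_pow] at h1 h2
    exact ENNReal.add_ne_top.2 ⟨h2.ne, h1.ne⟩
  set G := cutSet μ h r with hG
  have hGm : MeasurableSet G := measurableSet_cutSet hh r
  set U : Ω × Ω → ENNReal := fun p => ‖Function.uncurry h' p‖ₑ with hU
  set w : Ω × Ω → ENNReal := fun p => G.indicator 1 p.1 * ‖Function.uncurry h p‖ₑ with hw
  have hUm : Measurable U := hhm.enorm
  have hwm : Measurable w := ((measurable_one.indicator hGm).comp measurable_fst).mul hh.enorm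
  have hr0 : (r : ENNReal) ≠ 0 := by exact_mod_cast (by omega : r ≠ 0)
  have hle : ∫⁻ z, ‖cutVal G h' d' (v, a) z * cutVal G h d (v, b) z‖ₑ ∂seqLaw μ
      ≤ ∫⁻ z, U (z v, z a) * w (z v, z b) ∂seqLaw μ := by
    refine lintegral_mono fun z => ?_
    by_cases h1 : z v ∈ G <;> by_cases h2 : z a ∈ G <;> by_cases h3 : z b ∈ G <;>
      simp [cutVal, edgeVal, hva, hvb, h1, h2, h3, hU, hw, enorm_mul]
  have hB (x : Ω) : ∫⁻ y, w (x, y) ∂μ ≤ (r : ENNReal) ^ 2 := by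
    by_cases hx : x ∈ G
    · have h1 : ∫⁻ y, ‖h x y‖ₑ ∂μ ≤ (r : ENNReal) ^ 2 := hx
      simpa [hw, hx] using h1
    · simp [hw, hx]
  have hw1 : ∫⁻ x, ∫⁻ y, w (x, y) ∂μ ∂μ ≤ ∫⁻ p, ‖Function.uncurry h p‖ₑ ∂μ.prod μ := by
    rw [lintegral_prod _ hh.enorm.aemeasurable]
    refine lintegral_mono fun x => lintegral_mono fun y => ?_
    by_cases hx : x ∈ G <;> simp [hw, hx]
  have hU2 : Measurable fun p => U p ^ 2 := hUm.pow_const 2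
  have hmain : (r : ENNReal) * ∫⁻ z, U (z v, z a) * w (z v, z b) ∂seqLaw μ
      ≤ r * (r * (∫⁻ p, U p ^ 2 ∂μ.prod μ + ∫⁻ p, ‖Function.uncurry h p‖ₑ ∂μ.prod μ)) := by
    calc (r : ENNReal) * ∫⁻ z, U (z v, z a) * w (z v, z b) ∂seqLaw μ
        = ∫⁻ z, r * (U (z v, z a) * w (z v, z b)) ∂seqLaw μ :=
          (lintegral_const_mul _ (by fun_prop)).symm
      _ ≤ ∫⁻ z, (U (z v, z a) ^ 2 * w (z v, z b) + (fun _ => (r : ENNReal) ^ 2) (z v, z a)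
            * w (z v, z b)) ∂seqLaw μ := by
          refine lintegral_mono fun z => ?_
          rw [← mul_assoc, ← add_mul]
          refine mul_le_mul_left ?_ _
          rcases le_total (r : ENNReal) (U (z v, z a)) with hc | hc
          · exact (mul_le_mul_left hc _).trans ((pow_two (U (z v, z a))).ge.trans le_self_add)
          · exact (mul_le_mul_right hc _).trans ((pow_two (r : ENNReal)).ge.trans le_add_self)
      _ = ∫⁻ x, (∫⁻ y, U (x, y) ^ 2 ∂μ) * ∫⁻ y, w (x, y) ∂μ ∂μ
            + ∫⁻ x, (∫⁻ _, (r : ENNReal) ^ 2 ∂μ) * ∫⁻ y, w (x, y) ∂μ ∂μ := by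
          rw [lintegral_add_left (by fun_prop), lintegral_seqLaw_mul hU2 hwm hva hvb hab,
            lintegral_seqLaw_mul measurable_const hwm hva hvb hab]
      _ ≤ ∫⁻ x, (∫⁻ y, U (x, y) ^ 2 ∂μ) * (r : ENNReal) ^ 2 ∂μ
            + (r : ENNReal) ^ 2 * ∫⁻ p, ‖Function.uncurry h p‖ₑ ∂μ.prod μ := by
          refine add_le_add (lintegral_mono fun x => mul_le_mul_right (hB x) _) ?_
          simp only [lintegral_const, measure_univ, mul_one]
          rw [lintegral_const_mul _ hwm.lintegral_prod_right']
          exact mul_le_mul_right hw1 _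
      _ = r * (r * (∫⁻ p, U p ^ 2 ∂μ.prod μ + ∫⁻ p, ‖Function.uncurry h p‖ₑ ∂μ.prod μ)) := by
          rw [lintegral_mul_const _ hU2.lintegral_prod_right', lintegral_prod _ hU2.aemeasurable]
          ring
  exact hle.trans ((ENNReal.mul_le_mul_iff_right hr0 (ENNReal.natCast_ne_top r)).1 hmain)

end CutSet

lemma nodup_of_five_le_card {a b c d e : ℕ} (h : 5 ≤ ({a, b, c, d, e} : Finset ℕ).card) :
    [a, b, c, d, e].Nodup := by
  have h1 : [a, b, c, d, e].toFinset = {a, b, c, d, e} := by simp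
  rw [← h1] at h
  exact Multiset.toFinset_card_eq_card_iff_nodup.1
    (le_antisymm (List.toFinset_card_le [a, b, c, d, e]) h)

/-- The two pairs of indices have exactly one index in common. -/
def ShareOne (e e' : ℕ × ℕ) : Prop :=
  ∃ v a b, v ≠ a ∧ v ≠ b ∧ a ≠ b ∧ (e = (v, a) ∨ e = (a, v)) ∧ (e' = (v, b) ∨ e' = (b, v))

lemma disjoint_or_shareOne {e e' e'' : ℕ × ℕ}
    (h : 5 ≤ (verts e ∪ (verts e' ∪ verts e'')).card) :
    Disjoint (verts e ∪ verts e') (verts e'') ∨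
      (Disjoint (verts e) (verts e' ∪ verts e'') ∧ ShareOne e' e'') ∨
      (Disjoint (verts e') (verts e ∪ verts e'') ∧ ShareOne e e'') := by
  obtain ⟨a, b⟩ := e
  obtain ⟨c, d⟩ := e'
  obtain ⟨p, q⟩ := e''
  have hset : verts (a, b) ∪ (verts (c, d) ∪ verts (p, q)) = {a, b, c, d, p, q} := by
    ext x
    simp only [verts, Finset.mem_union, Finset.mem_insert, Finset.mem_singleton]
    tauto
  rw [hset] at h
  by_cases hdis : Disjoint (verts (a, b) ∪ verts (c, d)) (verts (p, q))
  · exact Or.inl hdis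
  right
  have hco : (p = a ∨ p = b ∨ p = c ∨ p = d) ∨ (q = a ∨ q = b ∨ q = c ∨ q = d) := by
    contrapose! hdis
    simp only [verts, Finset.disjoint_left, Finset.mem_union, Finset.mem_insert,
      Finset.mem_singleton]
    grind
  obtain ⟨y, x, hyx, hy, hnd⟩ : ∃ y x, (p = y ∧ q = x ∨ p = x ∧ q = y) ∧
      (y = a ∨ y = b ∨ y = c ∨ y = d) ∧ [a, b, c, d, x].Nodup := by
    rcases hco with hco | hco
    · refine ⟨p, q, Or.inl ⟨rfl, rfl⟩, hco,
        nodup_of_five_le_card (h.trans (Finset.card_le_card fun x => ?_))⟩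
      simp only [Finset.mem_insert, Finset.mem_singleton]
      grind
    · refine ⟨q, p, Or.inr ⟨rfl, rfl⟩, hco,
        nodup_of_five_le_card (h.trans (Finset.card_le_card fun x => ?_))⟩
      simp only [Finset.mem_insert, Finset.mem_singleton]
      grind
  simp only [List.nodup_cons, List.mem_cons, List.not_mem_nil, or_false, not_or] at hnd
  simp only [verts, Finset.disjoint_left, Finset.mem_union, Finset.mem_insert,
    Finset.mem_singleton]
  rcases hy with rfl | rfl | rfl | rfl
  · exact Or.inr ⟨by grind, y, b, x, by grind, by grind, by grind, by simp, by grind⟩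
  · exact Or.inr ⟨by grind, y, a, x, by grind, by grind, by grind, by simp, by grind⟩
  · exact Or.inl ⟨by grind, y, d, x, by grind, by grind, by grind, by simp, by grind⟩
  · exact Or.inl ⟨by grind, y, c, x, by grind, by grind, by grind, by simp, by grind⟩

section CutTriple

variable {Ω : Type*} {h : Ω → Ω → ℝ} {d : Ω → ℝ}

lemma cutVal_swap (hs : ∀ x y, h x y = h y x) (G : Set Ω) (i j : ℕ) :
    cutVal G h d (i, j) = cutVal G h d (j, i) := by
  ext z
  rcases eq_or_ne i j with rfl | hij
  · rfl
  · simp only [cutVal, edgeVal, hij, hij.symm, if_false, hs (z i) (z j)]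
    ring

variable [MeasurableSpace Ω] {μ : Measure Ω} [IsProbabilityMeasure μ]
  {h₁ h₂ : Ω → Ω → ℝ} {d₁ d₂ : Ω → ℝ}

lemma exists_cutVal_mul_bound (hm₁ : Measurable (Function.uncurry h₁)) (hd₁ : Measurable d₁)
    (hm₂ : Measurable (Function.uncurry h₂)) (hd₂ : Measurable d₂)
    (hs₁ : ∀ x y, h₁ x y = h₁ y x) (hs₂ : ∀ x y, h₂ x y = h₂ y x)
    (hL₁ : MemLp (Function.uncurry h₁) 2 (μ.prod μ))
    (hL₂ : Integrable (Function.uncurry h₂) (μ.prod μ)) :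
    ∃ C : ℝ, ∀ r : ℕ, 1 ≤ r → ∀ e e', ShareOne e e' →
      Integrable (fun z => cutVal (cutSet μ h₂ r) h₁ d₁ e z * cutVal (cutSet μ h₂ r) h₂ d₂ e' z)
        (seqLaw μ) ∧
      |∫ z, cutVal (cutSet μ h₂ r) h₁ d₁ e z * cutVal (cutSet μ h₂ r) h₂ d₂ e' z ∂seqLaw μ|
        ≤ r * C := by
  obtain ⟨C, hC, hb⟩ := lintegral_enorm_cutVal_mul_le hm₂ hL₂ hm₁ hL₁ d₂ d₁
  refine ⟨C.toReal, fun r hr e e' hee' => ?_⟩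
  obtain ⟨v, a, b, hva, hvb, hab, he, he'⟩ := hee'
  have h1 : cutVal (cutSet μ h₂ r) h₁ d₁ e = cutVal (cutSet μ h₂ r) h₁ d₁ (v, a) := by
    rcases he with rfl | rfl
    · rfl
    · exact cutVal_swap hs₁ _ _ _
  have h2 : cutVal (cutSet μ h₂ r) h₂ d₂ e' = cutVal (cutSet μ h₂ r) h₂ d₂ (v, b) := by
    rcases he' with rfl | rfl
    · rfl
    · exact cutVal_swap hs₂ _ _ _
  rw [h1, h2]
  have hle := hb r hr v a b hva hvb hab
  have htop : (r : ENNReal) * C ≠ ⊤ := ENNReal.mul_ne_top (ENNReal.natCast_ne_top r) hC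
  have hG := measurableSet_cutSet (μ := μ) hm₂ r
  refine ⟨⟨((measurable_cutVal hG hm₁ hd₁ _).mul
    (measurable_cutVal hG hm₂ hd₂ _)).aestronglyMeasurable, hle.trans_lt htop.lt_top⟩, ?_⟩
  rw [← Real.norm_eq_abs]
  refine (norm_integral_le_lintegral_norm _).trans ?_
  simp only [ofReal_norm]
  refine (ENNReal.toReal_mono htop hle).trans ?_
  simp

lemma cutVal_triple_of_disjoint_last (hm₁ : Measurable (Function.uncurry h₁))
    (hd₁ : Measurable d₁) (hm₂ : Measurable (Function.uncurry h₂)) (hd₂ : Measurable d₂)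
    (hL₂ : Integrable (Function.uncurry h₂) (μ.prod μ))
    (hE₁ : ∀ e, MemLp (edgeVal h₁ d₁ e) 2 (seqLaw μ))
    (hE₂ : ∀ e, Integrable (edgeVal h₂ d₂ e) (seqLaw μ))
    (h0₂ : ∀ e, ∫ z, edgeVal h₂ d₂ e z ∂seqLaw μ = 0)
    {e e' e'' : ℕ × ℕ} (hdis : Disjoint (verts e ∪ verts e') (verts e'')) :
    (∀ r, Integrable (fun z => cutVal (cutSet μ h₂ r) h₁ d₁ e z * (cutVal (cutSet μ h₂ r) h₁ d₁ e' z
      * cutVal (cutSet μ h₂ r) h₂ d₂ e'' z)) (seqLaw μ)) ∧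
    Filter.Tendsto (fun r => ∫ z, cutVal (cutSet μ h₂ r) h₁ d₁ e z *
      (cutVal (cutSet μ h₂ r) h₁ d₁ e' z * cutVal (cutSet μ h₂ r) h₂ d₂ e'' z) ∂seqLaw μ)
      Filter.atTop (nhds 0) := by
  have hG (r : ℕ) := measurableSet_cutSet (μ := μ) hm₂ r
  have hX (r : ℕ) (e) := measurable_cutVal (hG r) hm₁ hd₁ e
  have hY (r : ℕ) := measurable_cutVal (hG r) hm₂ hd₂ e''
  have hXL (r : ℕ) (e) := memLp_cutVal (hG r) hm₁ hd₁ (hE₁ e)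
  have hXX (r : ℕ) : Integrable (fun z => cutVal (cutSet μ h₂ r) h₁ d₁ e z *
      cutVal (cutSet μ h₂ r) h₁ d₁ e' z) (seqLaw μ) := (hXL r e).integrable_mul (hXL r e')
  have hYi (r : ℕ) : Integrable (cutVal (cutSet μ h₂ r) h₂ d₂ e'') (seqLaw μ) :=
    memLp_one_iff_integrable.1 (memLp_cutVal (hG r) hm₂ hd₂ (memLp_one_iff_integrable.2 (hE₂ _)))
  have hind (r : ℕ) : IndepFun (fun z => cutVal (cutSet μ h₂ r) h₁ d₁ e z *
      cutVal (cutSet μ h₂ r) h₁ d₁ e' z) (cutVal (cutSet μ h₂ r) h₂ d₂ e'') (seqLaw μ) :=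
    indepFun_of_dependsOn μ ((hX r e).mul (hX r e')) (hY r) hdis
      (dependsOn_mul (dependsOn_cutVal _ _ _ _) (dependsOn_cutVal _ _ _ _))
      (dependsOn_cutVal _ _ _ _)
  simp_rw [← mul_assoc]
  refine ⟨fun r => (hind r).integrable_mul (hXX r) (hYi r), ?_⟩
  have hlim := tendsto_integral_cutVal hG (ae_eventually_mem_cutSet hm₂ hL₂) hm₂ hd₂ (hE₂ e'')
  rw [h0₂] at hlim
  have hEE : Integrable (fun z => edgeVal h₁ d₁ e z * edgeVal h₁ d₁ e' z) (seqLaw μ) :=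
    (hE₁ e).integrable_mul (hE₁ e')
  have hbd (r : ℕ) : |∫ z, cutVal (cutSet μ h₂ r) h₁ d₁ e z *
      cutVal (cutSet μ h₂ r) h₁ d₁ e' z ∂seqLaw μ|
      ≤ ∫ z, |edgeVal h₁ d₁ e z * edgeVal h₁ d₁ e' z| ∂seqLaw μ := by
    refine abs_integral_le_integral_abs.trans (integral_mono (hXX r).abs hEE.abs fun z => ?_)
    simp only [abs_mul]
    exact mul_le_mul (abs_cutVal_le _ _ _ _ _) (abs_cutVal_le _ _ _ _ _) (abs_nonneg _)
      (abs_nonneg _)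
  refine squeeze_zero_norm (fun r => ?_)
    (by simpa only [abs_zero, mul_zero] using (hlim.abs.const_mul (∫ z, |edgeVal h₁ d₁ e z * edgeVal h₁ d₁ e' z| ∂seqLaw μ)))
  rw [(hind r).integral_fun_mul_eq_mul_integral (hXX r).aestronglyMeasurable
    (hYi r).aestronglyMeasurable, norm_mul, Real.norm_eq_abs, Real.norm_eq_abs]
  exact mul_le_mul_of_nonneg_right (hbd r) (abs_nonneg _)

lemma cutVal_triple_of_shareOne (hm₁ : Measurable (Function.uncurry h₁))
    (hd₁ : Measurable d₁) (hm₂ : Measurable (Function.uncurry h₂)) (hd₂ : Measurable d₂)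
    (hs₁ : ∀ x y, h₁ x y = h₁ y x) (hs₂ : ∀ x y, h₂ x y = h₂ y x)
    (hL₁ : MemLp (Function.uncurry h₁) 2 (μ.prod μ))
    (hL₂ : Integrable (Function.uncurry h₂) (μ.prod μ))
    (hE₁ : ∀ e, MemLp (edgeVal h₁ d₁ e) 2 (seqLaw μ))
    (h0₁ : ∀ e, ∫ z, edgeVal h₁ d₁ e z ∂seqLaw μ = 0)
    {e e' e'' : ℕ × ℕ} (hdis : Disjoint (verts e) (verts e' ∪ verts e''))
    (hsh : ShareOne e' e'') :
    (∀ r, 1 ≤ r → Integrable (fun z => cutVal (cutSet μ h₂ r) h₁ d₁ e z *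
      (cutVal (cutSet μ h₂ r) h₁ d₁ e' z * cutVal (cutSet μ h₂ r) h₂ d₂ e'' z)) (seqLaw μ)) ∧
    Filter.Tendsto (fun r => ∫ z, cutVal (cutSet μ h₂ r) h₁ d₁ e z *
      (cutVal (cutSet μ h₂ r) h₁ d₁ e' z * cutVal (cutSet μ h₂ r) h₂ d₂ e'' z) ∂seqLaw μ)
      Filter.atTop (nhds 0) := by
  obtain ⟨C, hC⟩ := exists_cutVal_mul_bound hm₁ hd₁ hm₂ hd₂ hs₁ hs₂ hL₁ hL₂
  have hG (r : ℕ) := measurableSet_cutSet (μ := μ) hm₂ r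
  have hX (r : ℕ) (e) := measurable_cutVal (hG r) hm₁ hd₁ e
  have hY (r : ℕ) := measurable_cutVal (hG r) hm₂ hd₂ e''
  have hXi (r : ℕ) : Integrable (cutVal (cutSet μ h₂ r) h₁ d₁ e) (seqLaw μ) :=
    (memLp_cutVal (hG r) hm₁ hd₁ (hE₁ e)).integrable one_le_two
  have hind (r : ℕ) : IndepFun (cutVal (cutSet μ h₂ r) h₁ d₁ e)
      (fun z => cutVal (cutSet μ h₂ r) h₁ d₁ e' z * cutVal (cutSet μ h₂ r) h₂ d₂ e'' z)
      (seqLaw μ) :=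
    indepFun_of_dependsOn μ (hX r e) ((hX r e').mul (hY r)) hdis (dependsOn_cutVal _ _ _ _)
      (dependsOn_mul (dependsOn_cutVal _ _ _ _) (dependsOn_cutVal _ _ _ _))
  refine ⟨fun r hr => (hind r).integrable_mul (hXi r) (hC r hr _ _ hsh).1, ?_⟩
  have hlim := (tendsto_mul_integral_cutVal hm₂ hL₂ hm₁ hd₁ (hE₁ e) (h0₁ e)).abs.mul_const C
  simp only [abs_zero, zero_mul] at hlim
  refine squeeze_zero_norm' ?_ hlim
  filter_upwards [Filter.eventually_ge_atTop 1] with r hr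
  rw [(hind r).integral_fun_mul_eq_mul_integral (hXi r).aestronglyMeasurable
    (hC r hr _ _ hsh).1.aestronglyMeasurable, norm_mul, Real.norm_eq_abs, Real.norm_eq_abs,
    abs_mul, Nat.abs_cast, mul_comm (r : ℝ), mul_assoc]
  exact mul_le_mul_of_nonneg_left (hC r hr _ _ hsh).2 (abs_nonneg _)

lemma cutVal_triple (hm₁ : Measurable (Function.uncurry h₁))
    (hd₁ : Measurable d₁) (hm₂ : Measurable (Function.uncurry h₂)) (hd₂ : Measurable d₂)
    (hs₁ : ∀ x y, h₁ x y = h₁ y x) (hs₂ : ∀ x y, h₂ x y = h₂ y x)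
    (hL₁ : MemLp (Function.uncurry h₁) 2 (μ.prod μ))
    (hL₂ : Integrable (Function.uncurry h₂) (μ.prod μ))
    (hE₁ : ∀ e, MemLp (edgeVal h₁ d₁ e) 2 (seqLaw μ))
    (hE₂ : ∀ e, Integrable (edgeVal h₂ d₂ e) (seqLaw μ))
    (h0₁ : ∀ e, ∫ z, edgeVal h₁ d₁ e z ∂seqLaw μ = 0)
    (h0₂ : ∀ e, ∫ z, edgeVal h₂ d₂ e z ∂seqLaw μ = 0)
    {e e' e'' : ℕ × ℕ} (hcard : 5 ≤ (verts e ∪ (verts e' ∪ verts e'')).card) :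
    (∀ r, 1 ≤ r → Integrable (fun z => cutVal (cutSet μ h₂ r) h₁ d₁ e z *
      (cutVal (cutSet μ h₂ r) h₁ d₁ e' z * cutVal (cutSet μ h₂ r) h₂ d₂ e'' z)) (seqLaw μ)) ∧
    Filter.Tendsto (fun r => ∫ z, cutVal (cutSet μ h₂ r) h₁ d₁ e z *
      (cutVal (cutSet μ h₂ r) h₁ d₁ e' z * cutVal (cutSet μ h₂ r) h₂ d₂ e'' z) ∂seqLaw μ)
      Filter.atTop (nhds 0) := by
  rcases disjoint_or_shareOne hcard with hdis | ⟨hdis, hsh⟩ | ⟨hdis, hsh⟩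
  · exact (cutVal_triple_of_disjoint_last hm₁ hd₁ hm₂ hd₂ hL₂ hE₁ hE₂ h0₂ hdis).imp_left
      fun hi r _ => hi r
  · exact cutVal_triple_of_shareOne hm₁ hd₁ hm₂ hd₂ hs₁ hs₂ hL₁ hL₂ hE₁ h0₁ hdis hsh
  · simp_rw [mul_left_comm (cutVal _ h₁ d₁ e _)]
    exact cutVal_triple_of_shareOne hm₁ hd₁ hm₂ hd₂ hs₁ hs₂ hL₁ hL₂ hE₁ h0₁ hdis hsh

end CutTriple

section Triple

/-- The indices occurring in a triple of pairs. -/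
def tripleVerts (t : (ℕ × ℕ) × (ℕ × ℕ) × (ℕ × ℕ)) : Finset ℕ :=
  verts t.1 ∪ (verts t.2.1 ∪ verts t.2.2)

/-- The triples of pairs of indices from `S`. -/
def triples (S : Finset ℕ) : Finset ((ℕ × ℕ) × (ℕ × ℕ) × (ℕ × ℕ)) :=
  (S ×ˢ S) ×ˢ ((S ×ˢ S) ×ˢ (S ×ˢ S))

lemma mem_triples (t) (S : Finset ℕ) : t ∈ triples S ↔ tripleVerts t ⊆ S := by
  simp only [triples, Finset.mem_product, tripleVerts, verts, Finset.union_subset_iff,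
    Finset.insert_subset_iff, Finset.singleton_subset_iff]

lemma card_verts_le (e : ℕ × ℕ) : (verts e).card ≤ 2 := Finset.card_le_two

lemma card_tripleVerts_le (t) : (tripleVerts t).card ≤ 6 := by
  have h1 := Finset.card_union_le (verts t.1) (verts t.2.1 ∪ verts t.2.2)
  have h2 := Finset.card_union_le (verts t.2.1) (verts t.2.2)
  have := card_verts_le t.1
  have := card_verts_le t.2.1
  have := card_verts_le t.2.2
  rw [tripleVerts]
  omega

variable {Ω : Type*}

/-- The product of kernels along a triple of pairs of indices. -/
noncomputable def tripleVal (h₁ : Ω → Ω → ℝ) (d₁ : Ω → ℝ) (h₂ : Ω → Ω → ℝ) (d₂ : Ω → ℝ)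
    (t : (ℕ × ℕ) × (ℕ × ℕ) × (ℕ × ℕ)) (z : ℕ → Ω) : ℝ :=
  edgeVal h₁ d₁ t.1 z * (edgeVal h₁ d₁ t.2.1 z * edgeVal h₂ d₂ t.2.2 z)

lemma sum_triples_tripleVal (h₁ : Ω → Ω → ℝ) (d₁ : Ω → ℝ) (h₂ : Ω → Ω → ℝ) (d₂ : Ω → ℝ)
    (S : Finset ℕ) (z : ℕ → Ω) : ∑ t ∈ triples S, tripleVal h₁ d₁ h₂ d₂ t z
      = pairSum h₁ d₁ S z ^ 2 * pairSum h₂ d₂ S z := by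
  simp only [triples, tripleVal, Finset.sum_product (S ×ˢ S), pairSum, pow_two, mul_assoc]
  simp only [← Finset.mul_sum, ← Finset.sum_mul]

lemma prod_indicator_mul_tripleVal {h₁ : Ω → Ω → ℝ} {d₁ : Ω → ℝ} {h₂ : Ω → Ω → ℝ}
    {d₂ : Ω → ℝ} (G : Set Ω) {t : (ℕ × ℕ) × (ℕ × ℕ) × (ℕ × ℕ)} {S : Finset ℕ}
    (ht : tripleVerts t = S) (z : ℕ → Ω) :
    (∏ i ∈ S, G.indicator 1 (z i)) * tripleVal h₁ d₁ h₂ d₂ t z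
      = cutVal G h₁ d₁ t.1 z * (cutVal G h₁ d₁ t.2.1 z * cutVal G h₂ d₂ t.2.2 z) := by
  subst ht
  by_cases hG : ∀ i ∈ tripleVerts t, z i ∈ G
  · rw [Finset.prod_eq_one fun i hi => by simp [hG i hi]]
    simp only [tripleVerts, verts, Finset.mem_union, Finset.mem_insert, Finset.mem_singleton]
      at hG
    simp [cutVal, tripleVal, hG]
  · push Not at hG
    obtain ⟨i, hi, hiG⟩ := hG
    rw [Finset.prod_eq_zero hi (by simp [hiG])]
    simp only [tripleVerts, verts, Finset.mem_union, Finset.mem_insert, Finset.mem_singleton]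
      at hi
    rcases hi with (rfl | rfl) | (rfl | rfl) | (rfl | rfl) <;> simp [cutVal, hiG]

variable [MeasurableSpace Ω] {μ : Measure Ω} [IsProbabilityMeasure μ]
  {h₁ h₂ : Ω → Ω → ℝ} {d₁ d₂ : Ω → ℝ}

lemma integral_exactSum_tripleVal_eq_zero (hm₁ : Measurable (Function.uncurry h₁))
    (hd₁ : Measurable d₁) (hm₂ : Measurable (Function.uncurry h₂)) (hd₂ : Measurable d₂)
    (hs₁ : ∀ x y, h₁ x y = h₁ y x) (hs₂ : ∀ x y, h₂ x y = h₂ y x)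
    (hL₁ : MemLp (Function.uncurry h₁) 2 (μ.prod μ))
    (hL₂ : Integrable (Function.uncurry h₂) (μ.prod μ))
    (hD₁ : MemLp d₁ 2 μ) (hD₂ : Integrable d₂ μ)
    (hh₁ : ∫ x, Function.uncurry h₁ x ∂μ.prod μ = 0) (hd₁0 : ∫ x, d₁ x ∂μ = 0)
    (hh₂ : ∫ x, Function.uncurry h₂ x ∂μ.prod μ = 0) (hd₂0 : ∫ x, d₂ x ∂μ = 0)
    {S : Finset ℕ} (hS : 4 < S.card)
    (hint : Integrable (exactSum tripleVerts triples (tripleVal h₁ d₁ h₂ d₂) S) (seqLaw μ)) :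
    ∫ z, exactSum tripleVerts triples (tripleVal h₁ d₁ h₂ d₂) S z ∂seqLaw μ = 0 := by
  set χ : ℕ → (ℕ → Ω) → ℝ := fun r z => ∏ i ∈ S, (cutSet μ h₂ r).indicator 1 (z i) with hχ
  have hχm (r : ℕ) : Measurable (χ r) := Finset.measurable_fun_prod _ fun i _ =>
    measurable_indicator_one_eval (measurableSet_cutSet hm₂ r) i
  have hχ1 (r : ℕ) (z : ℕ → Ω) : |χ r z| ≤ 1 := by
    rw [hχ, abs_of_nonneg (Finset.prod_nonneg fun i _ => indicator_one_nonneg _ _)]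
    exact Finset.prod_le_one (fun i _ => indicator_one_nonneg _ _)
      fun i _ => indicator_one_le_one _ _
  have hmem (t) (ht : t ∈ (triples S).filter fun t => tripleVerts t = S) :
      tripleVerts t = S := (Finset.mem_filter.1 ht).2
  have hsum (r : ℕ) (z : ℕ → Ω) :
      χ r z * exactSum tripleVerts triples (tripleVal h₁ d₁ h₂ d₂) S z
        = ∑ t ∈ triples S with tripleVerts t = S, cutVal (cutSet μ h₂ r) h₁ d₁ t.1 z *
          (cutVal (cutSet μ h₂ r) h₁ d₁ t.2.1 z * cutVal (cutSet μ h₂ r) h₂ d₂ t.2.2 z) := by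
    rw [exactSum, Finset.mul_sum]
    exact Finset.sum_congr rfl fun t ht => prod_indicator_mul_tripleVal _ (hmem t ht) z
  have htriple (t) (ht : t ∈ (triples S).filter fun t => tripleVerts t = S) :=
    cutVal_triple hm₁ hd₁ hm₂ hd₂ hs₁ hs₂ hL₁ hL₂ (memLp_edgeVal hL₁ hD₁)
      (fun e => memLp_one_iff_integrable.1 (memLp_edgeVal (memLp_one_iff_integrable.2 hL₂)
        (memLp_one_iff_integrable.2 hD₂) e))
      (integral_edgeVal_eq_zero hm₁ hd₁ hh₁ hd₁0) (integral_edgeVal_eq_zero hm₂ hd₂ hh₂ hd₂0)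
      (e := t.1) (e' := t.2.1) (e'' := t.2.2)
      (show 5 ≤ (tripleVerts t).card by rw [hmem t ht]; exact hS)
  have hlim0 : Filter.Tendsto (fun r => ∫ z, χ r z *
      exactSum tripleVerts triples (tripleVal h₁ d₁ h₂ d₂) S z ∂seqLaw μ) Filter.atTop
      (nhds 0) := by
    have h1 := tendsto_finsetSum _ fun t ht => (htriple t ht).2
    rw [Finset.sum_const_zero] at h1
    refine h1.congr' ?_
    filter_upwards [Filter.eventually_ge_atTop 1] with r hr
    simp_rw [hsum]
    rw [integral_finsetSum _ fun t ht => (htriple t ht).1 r hr]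
  refine tendsto_nhds_unique (tendsto_integral_of_dominated_convergence _
    (fun r => (hχm r).aestronglyMeasurable.mul hint.aestronglyMeasurable) hint.norm
    (fun r => Filter.Eventually.of_forall fun z => ?_) ?_) hlim0
  · rw [Pi.mul_apply, norm_mul]
    exact mul_le_of_le_one_left (norm_nonneg _) (hχ1 r z)
  · have : ∀ᵐ z ∂seqLaw μ, ∀ i ∈ S, ∀ᶠ r in Filter.atTop, z i ∈ cutSet μ h₂ r :=
      (ae_ball_iff S.countable_toSet).2 fun i _ =>
        ae_seqLaw_of_ae μ (ae_eventually_mem_cutSet hm₂ hL₂) i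
    filter_upwards [this] with z hz
    refine tendsto_const_nhds.congr' ?_
    filter_upwards [(Filter.eventually_all_finset S).2 hz] with r hr
    rw [Pi.mul_apply]
    simp only [hχ]
    rw [Finset.prod_eq_one fun i hi => by simp [hr i hi], one_mul]

end Triple

lemma exists_abs_le_of_eventually {a b : ℕ → ℝ} (hb : ∀ n, 1 ≤ n → 0 < b n) {N : ℕ} {C : ℝ}
    (h : ∀ n, N ≤ n → 1 ≤ n → |a n| ≤ C * b n) : ∃ C, ∀ n, 1 ≤ n → |a n| ≤ C * b n := by
  refine ⟨|C| + ∑ n ∈ Finset.range N, |(a n) / (b n)|, fun n hn => ?_⟩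
  have hbn := hb n hn
  have hsum : 0 ≤ ∑ n ∈ Finset.range N, |(a n) / (b n)| :=
    Finset.sum_nonneg fun _ _ => abs_nonneg _
  rcases lt_or_ge n N with hnN | hnN
  · have h1 : |(a n) / (b n)| ≤ ∑ n ∈ Finset.range N, |(a n) / (b n)| :=
      Finset.single_le_sum (f := fun n => |(a n) / (b n)|) (fun _ _ => abs_nonneg _)
        (Finset.mem_range.2 hnN)
    rw [abs_div, abs_of_pos hbn, div_le_iff₀ hbn] at h1
    exact h1.trans (mul_le_mul_of_nonneg_right (le_add_of_nonneg_left (abs_nonneg _)) hbn.le)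
  · exact (h n hnN hn).trans
      (mul_le_mul_of_nonneg_right ((le_abs_self C).trans (le_add_of_nonneg_right hsum)) hbn.le)

section Core

variable {Ω : Type*} [MeasurableSpace Ω] {μ : Measure Ω} [IsProbabilityMeasure μ]
  {h₁ h₂ : Ω → Ω → ℝ} {d₁ d₂ : Ω → ℝ}

lemma pairSum_ae_eq_zero {h : Ω → Ω → ℝ} {d : Ω → ℝ}
    (h0 : Function.uncurry h =ᵐ[μ.prod μ] 0 ∧ d =ᵐ[μ] 0) (S : Finset ℕ) :
    ∀ᵐ z ∂seqLaw μ, pairSum h d S z = 0 := by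
  have : ∀ᵐ z ∂seqLaw μ, ∀ e : ℕ × ℕ, edgeVal h d e z = 0 := by
    refine ae_all_iff.2 fun e => ?_
    by_cases he : e.1 = e.2
    · filter_upwards [ae_seqLaw_of_ae μ h0.2 e.1] with z hz
      simpa [edgeVal, he] using hz
    · filter_upwards [ae_seqLaw_of_ae_prod μ h0.1 he] with z hz
      simpa [edgeVal, he] using hz
  filter_upwards [this] with z hz
  exact Finset.sum_eq_zero fun e _ => hz e

/-- The mixed third moment of sums of centred kernels over all pairs of `n` indices is of order
`n ^ 4`. A kernel has to be centred only if it is integrable. -/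
theorem exists_integral_pairSum_sq_mul_le (hm₁ : Measurable (Function.uncurry h₁))
    (hd₁ : Measurable d₁) (hm₂ : Measurable (Function.uncurry h₂)) (hd₂ : Measurable d₂)
    (hs₁ : ∀ x y, h₁ x y = h₁ y x) (hs₂ : ∀ x y, h₂ x y = h₂ y x)
    (hD₁ : MemLp d₁ 2 μ) (hD₂ : Integrable d₂ μ)
    (hc₁ : Integrable (Function.uncurry h₁) (μ.prod μ) →
      ∫ x, Function.uncurry h₁ x ∂μ.prod μ = 0 ∧ ∫ x, d₁ x ∂μ = 0)
    (hc₂ : Integrable (Function.uncurry h₂) (μ.prod μ) →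
      ∫ x, Function.uncurry h₂ x ∂μ.prod μ = 0 ∧ ∫ x, d₂ x ∂μ = 0) :
    ∃ C : ℝ, ∀ n : ℕ, 1 ≤ n →
      |∫ z, pairSum h₁ d₁ (Finset.range n) z ^ 2 * pairSum h₂ d₂ (Finset.range n) z ∂seqLaw μ|
        ≤ C * (n : ℝ) ^ 4 := by
  have hdist {S S' : Finset ℕ} (hS : S.card = S'.card) :
      IdentDistrib (fun z => ∑ t ∈ triples S, tripleVal h₁ d₁ h₂ d₂ t z)
        (fun z => ∑ t ∈ triples S', tripleVal h₁ d₁ h₂ d₂ t z) (seqLaw μ) (seqLaw μ) := by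
    simp only [sum_triples_tripleVal]
    exact identDistrib_of_card_eq μ
      (G := fun S z => pairSum h₁ d₁ S z ^ 2 * pairSum h₂ d₂ S z)
      (fun S => ((measurable_pairSum hm₁ hd₁ S).pow_const 2).mul (measurable_pairSum hm₂ hd₂ S))
      (fun σ S z => by simp only [pairSum_map]) hS
  by_cases hinf : {n | Integrable (fun z => ∑ t ∈ triples (Finset.range n),
      tripleVal h₁ d₁ h₂ d₂ t z) (seqLaw μ)}.Infinite
  · have hint := integrable_of_infinite_card tripleVerts triples (tripleVal h₁ d₁ h₂ d₂) 6
      mem_triples card_tripleVerts_le (fun S S' hS => (hdist hS).integrable_iff.1) hinf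
    by_cases hz : (Function.uncurry h₁ =ᵐ[μ.prod μ] 0 ∧ d₁ =ᵐ[μ] 0) ∨
        (Function.uncurry h₂ =ᵐ[μ.prod μ] 0 ∧ d₂ =ᵐ[μ] 0)
    · refine ⟨0, fun n _ => ?_⟩
      have h0 : ∀ᵐ z ∂seqLaw μ, pairSum h₁ d₁ (Finset.range n) z ^ 2
          * pairSum h₂ d₂ (Finset.range n) z = 0 := by
        rcases hz with hz | hz <;>
        · filter_upwards [pairSum_ae_eq_zero hz (Finset.range n)] with z hz
          simp [hz]
      rw [integral_eq_zero_of_ae h0]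
      simp
    · obtain ⟨hz₁, hz₂⟩ := not_or.1 hz
      have hint' (S : Finset ℕ) : Integrable (fun z => |pairSum h₁ d₁ S z| ^ 2 *
          |pairSum h₂ d₂ S z| ^ 1) (seqLaw μ) := by
        have := (hint S).abs
        simp only [sum_triples_tripleVal, abs_mul, abs_pow] at this
        simpa only [pow_one] using this
      have hL₂ : Integrable (Function.uncurry h₂) (μ.prod μ) := by
        have := integrable_kernel_pow μ hm₁ hd₁ hs₁ hz₁ hm₂ hs₂ 2 1 hint'
        simp only [pow_one] at this
        exact (integrable_norm_iff hm₂.aestronglyMeasurable).1 this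
      have hL₁ : MemLp (Function.uncurry h₁) 2 (μ.prod μ) := by
        have := integrable_kernel_pow μ hm₂ hd₂ hs₂ hz₂ hm₁ hs₁ 1 2
          fun S => by simpa only [mul_comm] using hint' S
        simp only [sq_abs] at this
        exact (memLp_two_iff_integrable_sq hm₁.aestronglyMeasurable).2 this
      obtain ⟨hh₁, hd₁0⟩ := hc₁ (hL₁.integrable one_le_two)
      obtain ⟨hh₂, hd₂0⟩ := hc₂ hL₂
      simp only [← sum_triples_tripleVal]
      exact exists_integral_sum_le_pow mem_triples hint (fun S S' hS => (hdist hS).integral_eq) 4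
        fun S hS => integral_exactSum_tripleVal_eq_zero hm₁ hd₁ hm₂ hd₂ hs₁ hs₂ hL₁ hL₂ hD₁ hD₂
          hh₁ hd₁0 hh₂ hd₂0 hS (integrable_exactSum mem_triples hint S)
  · obtain ⟨N, hN⟩ := (Set.not_infinite.1 hinf).bddAbove
    refine exists_abs_le_of_eventually (b := fun n => (n : ℝ) ^ 4)
      (fun n hn => by positivity) (N := N + 1) (C := 0) fun n hn _ => ?_
    simp only [← sum_triples_tripleVal]
    rw [integral_undef fun hi => absurd (hN hi) (by omega)]
    simp

end Core

section Centering

variable {Ω : Type*} [MeasurableSpace Ω] {μ : Measure Ω} [IsProbabilityMeasure μ]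
  {h : Ω → Ω → ℝ} {d : Ω → ℝ}

lemma integrable_kernel_of_integrable_pairSum (hm : Measurable (Function.uncurry h))
    (hs : ∀ x y, h x y = h y x) (hint : ∀ S, Integrable (pairSum h d S) (seqLaw μ)) :
    Integrable (Function.uncurry h) (μ.prod μ) := by
  refine ((measurePreserving_pair μ zero_ne_one).integrable_comp hm.aestronglyMeasurable).1 ?_
  have h1 := (((hint (∅ ∪ {0} ∪ {1})).sub (hint (∅ ∪ {0}))).sub (hint (∅ ∪ {1}))).add (hint ∅)
  refine (h1.const_mul (1 / 2)).congr (Filter.Eventually.of_forall fun z => ?_)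
  have h2 := pairSum_mixed_difference hs d (Y := ∅) (K := {0}) (L := {1}) (by simp) (by simp)
    (by simp) z
  simp only [Finset.sum_singleton] at h2
  simp only [Pi.add_apply, Pi.sub_apply, h2, Function.comp_apply, Function.uncurry]
  ring

/-- Sums of a kernel minus their Bochner integrals are eventually sums of a single kernel, which
is centred if it is integrable. -/
lemma exists_pairSum_sub_integral (hm : Measurable (Function.uncurry h)) (hd : Measurable d)
    (hs : ∀ x y, h x y = h y x) (hD : MemLp d 2 μ) :
    ∃ (h' : Ω → Ω → ℝ) (d' : Ω → ℝ), Measurable (Function.uncurry h') ∧ Measurable d' ∧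
      (∀ x y, h' x y = h' y x) ∧ MemLp d' 2 μ ∧
      (Integrable (Function.uncurry h') (μ.prod μ) →
        ∫ x, Function.uncurry h' x ∂μ.prod μ = 0 ∧ ∫ x, d' x ∂μ = 0) ∧
      ∃ N, ∀ n, N ≤ n → ∀ z, pairSum h d (Finset.range n) z
        - ∫ z', pairSum h d (Finset.range n) z' ∂seqLaw μ = pairSum h' d' (Finset.range n) z := by
  have hDi : Integrable d μ := hD.integrable one_le_two
  by_cases hinf : {n | Integrable (pairSum h d (Finset.range n)) (seqLaw μ)}.Infinite
  · have hint : ∀ S, Integrable (pairSum h d S) (seqLaw μ) :=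
      integrable_of_infinite_card verts (fun S => S ×ˢ S) (edgeVal h d) 2
        (fun e S => by simp [verts, Finset.insert_subset_iff]) card_verts_le
        (fun S S' hS => (identDistrib_of_card_eq μ (G := pairSum h d) (measurable_pairSum hm hd)
          (pairSum_map h d) hS).integrable_iff.1) hinf
    have hL := integrable_kernel_of_integrable_pairSum hm hs hint
    set m := ∫ x, Function.uncurry h x ∂μ.prod μ with hmdef
    set b := ∫ x, d x ∂μ with hbdef
    have hm' : Measurable (Function.uncurry fun x y => h x y - m) := hm.sub_const m
    have hd' : Measurable fun x => d x - b := hd.sub_const b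
    have hh0 : ∫ x, Function.uncurry (fun x y => h x y - m) x ∂μ.prod μ = 0 := by
      have : Function.uncurry (fun x y => h x y - m) = fun x => Function.uncurry h x - m := rfl
      rw [this, integral_sub hL (integrable_const _), integral_const]
      simp [hmdef]
    have hd0 : ∫ x, d x - b ∂μ = 0 := by
      rw [integral_sub hDi (integrable_const _), integral_const]
      simp [hbdef]
    refine ⟨fun x y => h x y - m, fun x => d x - b, hm', hd', fun x y => by simp only [hs x y],
      hD.sub (memLp_const b), fun _ => ⟨hh0, hd0⟩, 0, fun n _ z => ?_⟩
    have hE (e : ℕ × ℕ) : Integrable (edgeVal h d e) (seqLaw μ) := memLp_one_iff_integrable.1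
      (memLp_edgeVal (memLp_one_iff_integrable.2 hL) (memLp_one_iff_integrable.2 hDi) e)
    have hval (e : ℕ × ℕ) (z : ℕ → Ω) : edgeVal (fun x y => h x y - m) (fun x => d x - b) e z
        = edgeVal h d e z - if e.1 = e.2 then b else m := by
      unfold edgeVal
      split_ifs <;> rfl
    have hEint (e : ℕ × ℕ) : ∫ z, edgeVal h d e z ∂seqLaw μ = if e.1 = e.2 then b else m := by
      have h1 := integral_edgeVal_eq_zero hm' hd' hh0 hd0 e
      simp only [hval] at h1
      rw [integral_sub (hE e) (integrable_const _), integral_const] at h1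
      simpa [sub_eq_zero] using h1
    simp only [pairSum]
    rw [integral_finsetSum _ fun e _ => hE e, ← Finset.sum_sub_distrib]
    exact Finset.sum_congr rfl fun e _ => by rw [hval, hEint]
  · obtain ⟨N, hN⟩ := (Set.not_infinite.1 hinf).bddAbove
    refine ⟨h, d, hm, hd, hs, hD, fun hL => (hinf ?_).elim, N + 1, fun n hn z => ?_⟩
    · have : {n | Integrable (pairSum h d (Finset.range n)) (seqLaw μ)} = Set.univ :=
        Set.eq_univ_of_forall fun n => integrable_finsetSum _ fun e _ =>
          memLp_one_iff_integrable.1 (memLp_edgeVal (memLp_one_iff_integrable.2 hL)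
            (memLp_one_iff_integrable.2 hDi) e)
      rw [this]
      exact Set.infinite_univ
    · rw [integral_undef fun hi => absurd (hN hi) (by omega), sub_zero]

end Centering

section PairAverage

instance : IsProbabilityMeasure _root_.stdGaussian := by
  unfold _root_.stdGaussian
  infer_instance

instance : IsProbabilityMeasure pairLaw := by
  unfold pairLaw
  infer_instance

lemma measurable_ghat (θ : ℝ) : Measurable (ghat θ) := by
  unfold ghat
  fun_prop

lemma measurable_Afun {θ : ℝ} {f : ℝ × ℝ → ℝ} (hf : Measurable f) (n : ℕ) :
    Measurable (Afun n θ f) := by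
  unfold Afun
  refine measurable_const.mul (Finset.measurable_fun_sum _ fun i _ =>
    Finset.measurable_fun_sum _ fun j _ => hf.comp ?_)
  exact (measurable_fst.comp (measurable_pi_apply i)).prodMk
    ((measurable_ghat θ).comp (measurable_pi_apply j))

/-- The off-diagonal kernel of a pair average, symmetrized. -/
noncomputable def symKernel (θ : ℝ) (f : ℝ × ℝ → ℝ) (x y : ℝ × ℝ) : ℝ :=
  (f (x.1, ghat θ y) + f (y.1, ghat θ x)) / 2

/-- The diagonal kernel of a pair average. -/
noncomputable def diagKernel (θ : ℝ) (f : ℝ × ℝ → ℝ) (x : ℝ × ℝ) : ℝ := f (x.1, ghat θ x)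

lemma measurable_diagKernel {θ : ℝ} {f : ℝ × ℝ → ℝ} (hf : Measurable f) :
    Measurable (diagKernel θ f) :=
  hf.comp (measurable_fst.prodMk (measurable_ghat θ))

lemma measurable_symKernel {θ : ℝ} {f : ℝ × ℝ → ℝ} (hf : Measurable f) :
    Measurable (Function.uncurry (symKernel θ f)) := by
  have hg := measurable_ghat θ
  unfold symKernel Function.uncurry
  fun_prop

lemma symKernel_comm (θ : ℝ) (f : ℝ × ℝ → ℝ) (x y : ℝ × ℝ) :
    symKernel θ f x y = symKernel θ f y x := by
  rw [symKernel, symKernel, add_comm]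

lemma memLp_diagKernel {θ : ℝ} {f : ℝ × ℝ → ℝ} (hf : Measurable f)
    (hf4 : Integrable (fun p : ℝ × ℝ => f (p.1, ghat θ p) ^ 4) pairLaw) :
    MemLp (diagKernel θ f) 2 pairLaw := by
  have hm := measurable_diagKernel (θ := θ) hf
  refine (memLp_two_iff_integrable_sq hm.aestronglyMeasurable).2 ?_
  refine ((integrable_const 1).add hf4).mono' (hm.pow_const 2).aestronglyMeasurable
    (Filter.Eventually.of_forall fun p => ?_)
  simp only [diagKernel, Pi.add_apply, Real.norm_eq_abs, abs_pow, sq_abs]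
  nlinarith [sq_nonneg (f (p.1, ghat θ p) ^ 2 - 1), sq_nonneg (f (p.1, ghat θ p) ^ 2)]

lemma sq_mul_Afun {θ : ℝ} {f : ℝ × ℝ → ℝ} {n : ℕ} (hn : 1 ≤ n) (z : ℕ → ℝ × ℝ) :
    (n : ℝ) ^ 2 * Afun n θ f (fun i => z i)
      = pairSum (symKernel θ f) (diagKernel θ f) (Finset.range n) z := by
  have hn0 : (n : ℝ) ≠ 0 := by positivity
  have h1 : ∑ i : Fin n, ∑ j : Fin n, f ((z i).1, ghat θ (z j))
      = ∑ i ∈ Finset.range n, ∑ j ∈ Finset.range n, f ((z i).1, ghat θ (z j)) := by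
    simp only [Finset.sum_range]
  have h2 (i j : ℕ) : edgeVal (symKernel θ f) (diagKernel θ f) (i, j) z
      = (f ((z i).1, ghat θ (z j)) + f ((z j).1, ghat θ (z i))) / 2 := by
    by_cases hij : i = j
    · subst hij
      simp [edgeVal, diagKernel]
    · simp [edgeVal, symKernel, hij]
  rw [Afun, h1, pairSum, Finset.sum_product]
  simp only [h2, ← Finset.sum_div, Finset.sum_add_distrib]
  rw [Finset.sum_comm (f := fun i j => f ((z j).1, ghat θ (z i)))]
  field_simp
  ring

lemma measurePreserving_piMeasure (n : ℕ) :
    MeasurePreserving (fun (z : ℕ → ℝ × ℝ) (i : Fin n) => z i) (seqLaw pairLaw) (piMeasure n) := by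
  refine ⟨by fun_prop, ?_⟩
  rw [piMeasure, ← Measure.infinitePi_eq_pi]
  exact Measure.map_infinitePi_infinitePi_of_inj (P := fun _ => pairLaw) Fin.val_injective

lemma integral_piMeasure {n : ℕ} {F : (Fin n → ℝ × ℝ) → ℝ} (hF : Measurable F) :
    ∫ ω, F ω ∂piMeasure n = ∫ z, F (fun i => z i) ∂seqLaw pairLaw := by
  rw [← (measurePreserving_piMeasure n).map_eq]
  exact integral_map (measurePreserving_piMeasure n).measurable.aemeasurable
    hF.aestronglyMeasurable

end PairAverage

/-- Mixed third-central-moment bound of order `n⁻²` for two pair averages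
`A₁ = (1/n²) Σ_{i,j} f₁(G_i, Ĝ_j)` and `A₂ = (1/n²) Σ_{i,j} f₂(G_i, Ĝ_j)`,
assuming `E[f₁(G,Ĝ)⁴] < ∞` and `E[f₂(G,Ĝ)⁴] < ∞`. -/
theorem mixed_moment_bound (θ : ℝ) (hθ : θ ∈ Set.Icc 0 Real.pi)
    (f₁ f₂ : ℝ × ℝ → ℝ) (hf₁ : Measurable f₁) (hf₂ : Measurable f₂)
    (hf₁4 : Integrable (fun p : ℝ × ℝ => f₁ (p.1, ghat θ p) ^ 4) pairLaw)
    (hf₂4 : Integrable (fun p : ℝ × ℝ => f₂ (p.1, ghat θ p) ^ 4) pairLaw) :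
    ∃ C : ℝ, ∀ n : ℕ, 1 ≤ n →
      |∫ ω, (Afun n θ f₁ ω - ∫ ω', Afun n θ f₁ ω' ∂piMeasure n) ^ 2
          * (Afun n θ f₂ ω - ∫ ω', Afun n θ f₂ ω' ∂piMeasure n) ∂piMeasure n|
        ≤ C / (n : ℝ) ^ 2 := by
  obtain ⟨h₁, d₁, hm₁, hd₁, hs₁, hD₁, hc₁, N₁, hN₁⟩ := exists_pairSum_sub_integral
    (measurable_symKernel (θ := θ) hf₁) (measurable_diagKernel hf₁) (symKernel_comm θ f₁)
    (memLp_diagKernel hf₁ hf₁4)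
  obtain ⟨h₂, d₂, hm₂, hd₂, hs₂, hD₂, hc₂, N₂, hN₂⟩ := exists_pairSum_sub_integral
    (measurable_symKernel (θ := θ) hf₂) (measurable_diagKernel hf₂) (symKernel_comm θ f₂)
    (memLp_diagKernel hf₂ hf₂4)
  obtain ⟨C, hC⟩ := exists_integral_pairSum_sq_mul_le hm₁ hd₁ hm₂ hd₂ hs₁ hs₂ hD₁
    (hD₂.integrable one_le_two) hc₁ hc₂
  have hcenter {f : ℝ × ℝ → ℝ} (hf : Measurable f) {n : ℕ} (hn : 1 ≤ n) (z : ℕ → ℝ × ℝ) :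
      Afun n θ f (fun i => z i) - ∫ ω', Afun n θ f ω' ∂piMeasure n
        = (pairSum (symKernel θ f) (diagKernel θ f) (Finset.range n) z
          - ∫ z', pairSum (symKernel θ f) (diagKernel θ f) (Finset.range n) z' ∂seqLaw pairLaw)
            / (n : ℝ) ^ 2 := by
    have hn0 : (n : ℝ) ^ 2 ≠ 0 := by positivity
    rw [integral_piMeasure (measurable_Afun hf n)]
    simp_rw [← sq_mul_Afun (θ := θ) (f := f) hn]
    rw [integral_const_mul, ← mul_sub, mul_div_cancel_left₀ _ hn0]
  simp only [div_eq_mul_inv]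
  refine exists_abs_le_of_eventually (b := fun n => ((n : ℝ) ^ 2)⁻¹) (fun n hn => by positivity)
    (N := max N₁ N₂) (C := C) fun n hn hn1 => ?_
  have hn0 : (n : ℝ) ≠ 0 := by positivity
  have hmeas (a b : ℝ) : Measurable fun ω => (Afun n θ f₁ ω - a) ^ 2 * (Afun n θ f₂ ω - b) :=
    (((measurable_Afun hf₁ n).sub_const a).pow_const 2).mul ((measurable_Afun hf₂ n).sub_const b)
  rw [integral_piMeasure (hmeas _ _)]
  simp only [hcenter hf₁ hn1, hcenter hf₂ hn1, hN₁ n (le_of_max_le_left hn),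
    hN₂ n (le_of_max_le_right hn)]
  have hdiv (z : ℕ → ℝ × ℝ) : (pairSum h₁ d₁ (Finset.range n) z / (n : ℝ) ^ 2) ^ 2
      * (pairSum h₂ d₂ (Finset.range n) z / (n : ℝ) ^ 2)
      = ((n : ℝ) ^ 6)⁻¹ * (pairSum h₁ d₁ (Finset.range n) z ^ 2
        * pairSum h₂ d₂ (Finset.range n) z) := by
    field_simp
  simp_rw [hdiv]
  rw [integral_const_mul, abs_mul, abs_of_nonneg (by positivity)]
  calc ((n : ℝ) ^ 6)⁻¹ * _ ≤ ((n : ℝ) ^ 6)⁻¹ * (C * (n : ℝ) ^ 4) :=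
        mul_le_mul_of_nonneg_left (hC n hn1) (by positivity)
    _ = C * ((n : ℝ) ^ 2)⁻¹ := by field_simp
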